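/- arXiv:1302.2745 — 2 statements merged into one kernel-verified Lean document; each statement's English description precedes it below -/
import Mathlib

section
/- Let Δ be a finite simple graph with vertex set V, n = |V|, and G = G_Δ the associated right-angled Artin group. Then there exists an automorphism μ of G/G' such that the twisted G'-fibre product H_μ = {(g₁,g₂) ∈ G × G : μ(g₁G') = g₂G'} is finitely presented if and only if n ≤ 2|S| for every minimal separating set S of Δ. -/
/-- A group is finitely presented if it is the quotient of a finitely generated free group
by the normal closure of finitely many relators. -/
def FinitelyPresentedGroup (G : Type*) [Group G] : Prop :=
  ∃ (n : ℕ) (f : FreeGroup (Fin n) →* G) (S : Finset (FreeGroup (Fin n))),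
    Function.Surjective f ∧ f.ker = Subgroup.normalClosure (S : Set (FreeGroup (Fin n)))

/-- The fibre product associated to an isomorphism `μ : G₁⧸N₁ ≃* G₂⧸N₂`. -/
def fibreProduct {G₁ G₂ : Type*} [Group G₁] [Group G₂]
    (N₁ : Subgroup G₁) (N₂ : Subgroup G₂) [N₁.Normal] [N₂.Normal]
    (μ : (G₁ ⧸ N₁) ≃* (G₂ ⧸ N₂)) : Subgroup (G₁ × G₂) where
  carrier := {p | μ (QuotientGroup.mk p.1) = QuotientGroup.mk p.2}
  one_mem' := by simp
  mul_mem' := by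
    intro a b ha hb
    simp only [Set.mem_setOf_eq] at *
    rw [Prod.fst_mul, Prod.snd_mul, QuotientGroup.mk_mul, QuotientGroup.mk_mul, map_mul, ha, hb]
  inv_mem' := by
    intro a ha
    simp only [Set.mem_setOf_eq] at *
    rw [Prod.fst_inv, Prod.snd_inv, QuotientGroup.mk_inv, QuotientGroup.mk_inv, map_inv, ha]

/-- The commutation relators of a simple graph: one commutator for each edge. -/
def raagRels {V : Type*} (Δ : SimpleGraph V) : Set (FreeGroup V) :=
  {r | ∃ u v : V, Δ.Adj u v ∧
    r = FreeGroup.of u * FreeGroup.of v * (FreeGroup.of u)⁻¹ * (FreeGroup.of v)⁻¹}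

/-- The right-angled Artin group associated to a simple graph `Δ`. -/
def RAAG {V : Type*} (Δ : SimpleGraph V) : Type _ :=
  PresentedGroup (raagRels Δ)

instance {V : Type*} (Δ : SimpleGraph V) : Group (RAAG Δ) :=
  inferInstanceAs (Group (PresentedGroup (raagRels Δ)))

/-- `S` is a minimal separating set of vertices: the subgraph induced on the complement of
`S` is disconnected, and this fails for every proper subset of `S`. -/
def IsMinimalSeparating {V : Type*} (Δ : SimpleGraph V) (S : Finset V) : Prop :=
  ¬ (SimpleGraph.induce ((↑S : Set V)ᶜ) Δ).Preconnected ∧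
    ∀ T : Finset V, T ⊂ S → (SimpleGraph.induce ((↑T : Set V)ᶜ) Δ).Preconnected

section RaagBasics

variable {V : Type*} {Δ : SimpleGraph V}

/-- The standard generator of the right-angled Artin group. -/
def raagOf (Δ : SimpleGraph V) (v : V) : RAAG Δ :=
  PresentedGroup.of (rels := raagRels Δ) v

/-- Universal property of the right-angled Artin group. -/
def raagLift (Δ : SimpleGraph V) {T : Type*} [Group T] (f : V → T)
    (hf : ∀ u v, Δ.Adj u v → f u * f v = f v * f u) : RAAG Δ →* T :=
  PresentedGroup.toGroup (rels := raagRels Δ) (f := f) (by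
    rintro r ⟨u, v, huv, rfl⟩
    simp only [map_mul, map_inv, FreeGroup.lift_apply_of]
    rw [hf u v huv]
    group)

theorem raagLift_of {T : Type*} [Group T] (f : V → T)
    (hf : ∀ u v, Δ.Adj u v → f u * f v = f v * f u) (v : V) :
    raagLift Δ f hf (raagOf Δ v) = f v := by
  unfold raagLift raagOf
  exact PresentedGroup.toGroup.of _

theorem raag_hom_ext {T : Type*} [Group T] {f g : RAAG Δ →* T}
    (h : ∀ v, f (raagOf Δ v) = g (raagOf Δ v)) : f = g :=
  PresentedGroup.ext (rels := raagRels Δ) (φ := f) (ψ := g) h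

theorem raagOf_comm {u v : V} (h : Δ.Adj u v) :
    raagOf Δ u * raagOf Δ v = raagOf Δ v * raagOf Δ u := by
  have : (PresentedGroup.mk (raagRels Δ)) (FreeGroup.of u * FreeGroup.of v *
      (FreeGroup.of u)⁻¹ * (FreeGroup.of v)⁻¹) = 1 :=
    PresentedGroup.one_of_mem ⟨u, v, h, rfl⟩
  rw [map_mul, map_mul, map_mul, map_inv, map_inv] at this
  have h2 := mul_inv_eq_one.mp this
  exact mul_inv_eq_iff_eq_mul.mp h2

/-- The abelianization map onto `ℤ^V`. -/
def raagAb [DecidableEq V] (Δ : SimpleGraph V) : RAAG Δ →* Multiplicative (V → ℤ) :=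
  raagLift Δ (fun v => Multiplicative.ofAdd (Pi.single v 1)) (fun _ _ _ => mul_comm _ _)

theorem raagAb_of [DecidableEq V] (v : V) :
    raagAb Δ (raagOf Δ v) = Multiplicative.ofAdd (Pi.single v 1) := raagLift_of _ _ v

theorem raag_mk_eq [DecidableEq V] [Fintype V] (g : RAAG Δ) :
    Abelianization.of g = ∏ v, (Abelianization.of (raagOf Δ v)) ^ ((raagAb Δ g).toAdd v) := by
  let A := Abelianization (RAAG Δ)
  let φ : RAAG Δ →* A := Abelianization.of
  let ψ : RAAG Δ →* A :=
    { toFun := fun g => ∏ v, φ (raagOf Δ v) ^ ((raagAb Δ g).toAdd v)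
      map_one' := by simp
      map_mul' := fun a b => by
        simp [zpow_add, Finset.prod_mul_distrib] }
  have : φ = ψ := by
    apply raag_hom_ext
    intro v
    change _ = ∏ u, φ (raagOf Δ u) ^ ((raagAb Δ (raagOf Δ v)).toAdd u)
    rw [raagAb_of, Finset.prod_eq_single v]
    · simp
    · intro u _ hu; simp [hu]
    · simp
  exact DFunLike.congr_fun this g

theorem raagAb_ker [DecidableEq V] [Fintype V] : (raagAb Δ).ker = commutator (RAAG Δ) := by
  apply le_antisymm
  · intro g hg
    rw [MonoidHom.mem_ker] at hg
    have := raag_mk_eq g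
    rw [hg] at this
    simp only [toAdd_one, Pi.zero_apply, zpow_zero, Finset.prod_const_one] at this
    exact (QuotientGroup.eq_one_iff g).mp this
  · exact Abelianization.commutator_subset_ker _

theorem raagAb_surjective [DecidableEq V] [Fintype V] : Function.Surjective (raagAb Δ) := by
  intro x
  rw [← MonoidHom.mem_range]
  have : x = ∏ v, (Multiplicative.ofAdd (Pi.single v 1 : V → ℤ)) ^ (x.toAdd v) := by
    apply Multiplicative.toAdd.injective
    rw [toAdd_prod]
    ext u
    simp [Finset.sum_apply, Pi.single_apply]
  rw [this]
  apply Subgroup.prod_mem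
  intro v _
  apply Subgroup.zpow_mem
  exact ⟨raagOf Δ v, raagAb_of v⟩

/-- The quotient of the group by its commutator subgroup is `ℤ^V`. -/
noncomputable def raagAbEquiv [DecidableEq V] [Fintype V] (Δ : SimpleGraph V) :
    (RAAG Δ ⧸ commutator (RAAG Δ)) ≃* Multiplicative (V → ℤ) :=
  (QuotientGroup.quotientMulEquivOfEq raagAb_ker.symm).trans
    (QuotientGroup.quotientKerEquivOfSurjective (raagAb Δ) raagAb_surjective)

theorem raagAbEquiv_mk [DecidableEq V] [Fintype V] (g : RAAG Δ) :
    raagAbEquiv Δ (QuotientGroup.mk g) = raagAb Δ g := rfl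

end RaagBasics

section Retract

theorem fp_of_finite_type {H : Type*} [Group H] {X : Type*} [Finite X]
    (k : FreeGroup X →* H) (hk : Function.Surjective k) (S : Set (FreeGroup X)) (hS : S.Finite)
    (h : k.ker = Subgroup.normalClosure S) : FinitelyPresentedGroup H := by
  classical
  obtain ⟨n, ⟨e⟩⟩ := Finite.exists_equiv_fin X
  let E : FreeGroup X ≃* FreeGroup (Fin n) := FreeGroup.freeGroupCongr e
  refine ⟨n, k.comp E.symm.toMonoidHom, (hS.image E).toFinset, ?_, ?_⟩
  · exact hk.comp E.symm.surjective
  · rw [Set.Finite.coe_toFinset]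
    have h1 : (k.comp E.symm.toMonoidHom).ker = k.ker.map E.toMonoidHom := by
      ext x
      rw [Subgroup.mem_map_equiv]
      rfl
    rw [h1, h]
    exact Subgroup.map_normalClosure S E.toMonoidHom E.surjective

/-- A retract of a finitely presented group is finitely presented. -/
theorem fp_of_retract {H : Type*} [Group H] {X : Type*} [Finite X]
    (R : Set (FreeGroup X)) (hR : R.Finite) (k : PresentedGroup R →* H)
    (ψ : H →* PresentedGroup R) (hψ : ∀ h, k (ψ h) = h) : FinitelyPresentedGroup H := by
  classical
  let m : FreeGroup X →* PresentedGroup R := PresentedGroup.mk R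
  have hm : Function.Surjective m := PresentedGroup.mk_surjective R
  choose s hs using hm
  let k' := k.comp m
  let R' : Set (FreeGroup X) := R ∪ Set.range (fun x => (FreeGroup.of x)⁻¹ * s (ψ (k' (FreeGroup.of x))))
  apply fp_of_finite_type k' (S := R')
  · intro h
    exact ⟨s (ψ h), by simp [k', hs, hψ]⟩
  · exact hR.union (Set.finite_range _)
  · apply le_antisymm
    · let q : FreeGroup X →* FreeGroup X ⧸ Subgroup.normalClosure R' := QuotientGroup.mk' _
      let l : PresentedGroup R →* FreeGroup X ⧸ Subgroup.normalClosure R' :=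
        PresentedGroup.toGroup (f := fun x => q (FreeGroup.of x)) (by
          intro r hr
          have : FreeGroup.lift (fun x => q (FreeGroup.of x)) = q := by
            ext x; simp
          rw [this]
          exact (QuotientGroup.eq_one_iff r).mpr (Subgroup.subset_normalClosure (Or.inl hr)))
      have hl : l.comp m = q := by
        ext x
        exact PresentedGroup.toGroup.of (rels := R) (f := fun x => q (FreeGroup.of x)) (by
          intro r hr
          have : FreeGroup.lift (fun x => q (FreeGroup.of x)) = q := by
            ext x; simp
          rw [this]
          exact (QuotientGroup.eq_one_iff r).mpr (Subgroup.subset_normalClosure (Or.inl hr)))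
      have : q = (l.comp ψ).comp k' := by
        ext x
        have h1 : q ((FreeGroup.of x)⁻¹ * s (ψ (k' (FreeGroup.of x)))) = 1 :=
          (QuotientGroup.eq_one_iff _).mpr (Subgroup.subset_normalClosure (Or.inr ⟨x, rfl⟩))
        rw [map_mul, map_inv, inv_mul_eq_one] at h1
        rw [h1, ← hl]
        simp [hs]
      intro w hw
      rw [MonoidHom.mem_ker] at hw
      have h2 : q w = 1 := by rw [this]; simp [hw]
      exact (QuotientGroup.eq_one_iff w).mp h2
    · apply Subgroup.normalClosure_le_normal
      rintro r (hr | ⟨x, rfl⟩)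
      · have : m r = 1 := PresentedGroup.one_of_mem hr
        simp [k', this]
      · simp [k', hs, hψ]

end Retract

section Necessity

open scoped commutatorElement

/-- Upper triangular `3 × 3` rational matrices with diagonal `(1, l, 1)`. -/
@[ext]
structure HeisGrp where
  l : ℚˣ
  x : ℚ
  y : ℚ
  z : ℚ

namespace HeisGrp

instance : Mul HeisGrp :=
  ⟨fun a b => ⟨a.l * b.l, b.x + a.x * b.l, a.l * b.y + a.y, b.z + a.x * b.y + a.z⟩⟩
instance : One HeisGrp := ⟨⟨1, 0, 0, 0⟩⟩
instance : Inv HeisGrp :=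
  ⟨fun a => ⟨a.l⁻¹, -a.x * (a.l⁻¹ : ℚˣ), -(a.l⁻¹ : ℚˣ) * a.y,
    a.x * (a.l⁻¹ : ℚˣ) * a.y - a.z⟩⟩

theorem mul_l (a b : HeisGrp) : (a * b).l = a.l * b.l := rfl
theorem mul_x (a b : HeisGrp) : (a * b).x = b.x + a.x * b.l := rfl
theorem mul_y (a b : HeisGrp) : (a * b).y = a.l * b.y + a.y := rfl
theorem mul_z (a b : HeisGrp) : (a * b).z = b.z + a.x * b.y + a.z := rfl
theorem one_l : (1 : HeisGrp).l = 1 := rfl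
theorem one_x : (1 : HeisGrp).x = 0 := rfl
theorem one_y : (1 : HeisGrp).y = 0 := rfl
theorem one_z : (1 : HeisGrp).z = 0 := rfl
theorem inv_l (a : HeisGrp) : (a⁻¹).l = a.l⁻¹ := rfl
theorem inv_x (a : HeisGrp) : (a⁻¹).x = -a.x * (a.l⁻¹ : ℚˣ) := rfl
theorem inv_y (a : HeisGrp) : (a⁻¹).y = -(a.l⁻¹ : ℚˣ) * a.y := rfl
theorem inv_z (a : HeisGrp) : (a⁻¹).z = a.x * (a.l⁻¹ : ℚˣ) * a.y - a.z := rfl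

instance : Group HeisGrp :=
  Group.ofLeftAxioms
    (by
      intro a b c
      ext
      · simp [mul_l, mul_assoc]
      · simp only [mul_x, mul_l, Units.val_mul]; ring
      · simp only [mul_y, mul_l, Units.val_mul]; ring
      · simp only [mul_z, mul_x, mul_y, mul_l]; ring)
    (by
      intro a
      ext <;> simp [mul_l, mul_x, mul_y, mul_z, one_l, one_x, one_y, one_z])
    (by
      intro a
      ext
      · simp [mul_l, inv_l, one_l]
      · simp [mul_x, inv_x, one_x]
      · simp [mul_y, inv_y, inv_l, one_y]
      · simp only [mul_z, inv_z, inv_x, one_z]; ring)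

/-- Projection to the upper left block. -/
def prX : HeisGrp →* HeisGrp where
  toFun a := ⟨a.l, a.x, 0, 0⟩
  map_one' := rfl
  map_mul' a b := by ext <;> simp [mul_l, mul_x, mul_y, mul_z]

/-- Projection to the lower right block. -/
def prY : HeisGrp →* HeisGrp where
  toFun a := ⟨a.l, 0, a.y, 0⟩
  map_one' := rfl
  map_mul' a b := by ext <;> simp [mul_l, mul_x, mul_y, mul_z]

/-- The central subgroup attached to a group of corner entries. -/
def corner (D : AddSubgroup ℚ) : Subgroup HeisGrp where
  carrier := {a | a.l = 1 ∧ a.x = 0 ∧ a.y = 0 ∧ a.z ∈ D}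
  one_mem' := ⟨rfl, rfl, rfl, D.zero_mem⟩
  mul_mem' := by
    rintro a b ⟨h1, h2, h3, h4⟩ ⟨k1, k2, k3, k4⟩
    refine ⟨by simp [mul_l, h1, k1], by simp [mul_x, h2, k2], by simp [mul_y, h3, k3], ?_⟩
    rw [mul_z, h2, zero_mul, add_zero]
    exact D.add_mem k4 h4
  inv_mem' := by
    rintro a ⟨h1, h2, h3, h4⟩
    refine ⟨by simp [inv_l, h1], by simp [inv_x, h2], by simp [inv_y, h3], ?_⟩
    rw [inv_z, h2]
    simpa using h4

theorem mem_corner {D : AddSubgroup ℚ} {a : HeisGrp} :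
    a ∈ corner D ↔ a.l = 1 ∧ a.x = 0 ∧ a.y = 0 ∧ a.z ∈ D := Iff.rfl

instance (D : AddSubgroup ℚ) : (corner D).Normal := by
  constructor
  rintro a ⟨h1, h2, h3, h4⟩ g
  have : g * a * g⁻¹ = a := by
    rw [mul_inv_eq_iff_eq_mul]
    ext <;> simp [mul_l, mul_x, mul_y, mul_z, h1, h2, h3, add_comm]
  rw [this]
  exact ⟨h1, h2, h3, h4⟩

end HeisGrp

theorem sep_cocycle {V : Type*} (Δ : SimpleGraph V) (S : Finset V)
    (hS : ¬ (SimpleGraph.induce ((↑S : Set V)ᶜ) Δ).Preconnected) (c : V → ℤ)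
    (hc : ∀ s ∈ S, c s = 0) (hc0 : c ≠ 0) :
    ∃ x : V → ℚ, (∀ u v, Δ.Adj u v → x u * ((2 : ℚ) ^ c v - 1) = x v * ((2 : ℚ) ^ c u - 1)) ∧
      ∃ a b, x a * ((2 : ℚ) ^ c b - 1) ≠ x b * ((2 : ℚ) ^ c a - 1) := by
  classical
  have pow_ne : ∀ m : ℤ, m ≠ 0 → (2 : ℚ) ^ m - 1 ≠ 0 := by
    intro m hm h
    have := sub_eq_zero.mp h
    rw [zpow_eq_one_iff_right₀ (by norm_num) (by norm_num)] at this
    exact hm this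
  unfold SimpleGraph.Preconnected at hS
  push Not at hS
  obtain ⟨a₀, b₀, hab⟩ := hS
  let A : V → Prop := fun v => ∃ h : v ∈ ((↑S : Set V)ᶜ),
    (SimpleGraph.induce ((↑S : Set V)ᶜ) Δ).Reachable a₀ ⟨v, h⟩
  have hA0 : A a₀ := ⟨a₀.2, SimpleGraph.Reachable.refl _⟩
  have hB0 : ¬ A b₀ := fun ⟨_, h⟩ => hab h
  have hAS : ∀ v, A v → v ∉ S := fun v ⟨h, _⟩ => by simpa using h
  have hb0S : (b₀ : V) ∉ S := fun h => b₀.2 (Finset.mem_coe.mpr h)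
  have hAadj : ∀ u v, Δ.Adj u v → A u → v ∉ S → A v := by
    rintro u v huv ⟨hu, hr⟩ hv
    refine ⟨by simpa using hv, hr.trans ?_⟩
    apply SimpleGraph.Adj.reachable
    exact huv
  obtain ⟨w, hw⟩ : ∃ w, c w ≠ 0 := by
    by_contra h; push Not at h; exact hc0 (funext h)
  have hwS : w ∉ S := fun h => hw (hc w h)
  by_cases h1 : ∃ a, A a ∧ c a ≠ 0
  · obtain ⟨a, ha, hca⟩ := h1
    by_cases h2 : ∃ b, ¬ A b ∧ c b ≠ 0
    · obtain ⟨b, hb, hcb⟩ := h2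
      refine ⟨fun v => if A v then 0 else (2 : ℚ) ^ c v - 1, ?_, a, b, ?_⟩
      · intro u v huv
        by_cases hu : A u <;> by_cases hv : A v
        · simp [hu, hv]
        · have : c v = 0 := hc v (by by_contra h; exact hv (hAadj u v huv hu h))
          simp [hu, hv, this]
        · have : c u = 0 := hc u (by by_contra h; exact hu (hAadj v u huv.symm hv h))
          simp [hu, hv, this]
        · simp [hu, hv, mul_comm]
      · simp only [ha, hb, if_true, if_false, zero_mul]
        exact (mul_ne_zero (pow_ne _ hcb) (pow_ne _ hca)).symm
    · push Not at h2
      -- `c` vanishes off `A`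
      refine ⟨fun v => if A v ∨ v ∈ S then 0 else 1, ?_, a, b₀, ?_⟩
      · intro u v huv
        by_cases hu : A u
        · by_cases hv : A v
          · simp [hu, hv]
          · have : v ∈ S := (by by_contra h; exact hv (hAadj u v huv hu h))
            simp [hu, this]
        · by_cases hv : A v
          · have : u ∈ S := (by by_contra h; exact hu (hAadj v u huv.symm hv h))
            simp [hv, this]
          · simp [h2 u hu, h2 v hv]
      · simp only [ha, hB0, hb0S, or_false, true_or, if_true, if_false, zero_mul, one_mul]
        exact (pow_ne _ hca).symm
  · push Not at h1
    have hwA : ¬ A w := fun h => hw (h1 w h)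
    refine ⟨fun v => if A v then 1 else 0, ?_, a₀, w, ?_⟩
    · intro u v huv
      by_cases hu : A u <;> by_cases hv : A v
      · simp [h1 u hu, h1 v hv]
      · have : c v = 0 := hc v (by by_contra h; exact hv (hAadj u v huv hu h))
        simp [hv, this]
      · have : c u = 0 := hc u (by by_contra h; exact hu (hAadj v u huv.symm hv h))
        simp [hu, this]
      · simp [hu, hv]
    · simp only [hA0, hwA, if_true, if_false, zero_mul, one_mul]
      exact pow_ne _ hw

theorem fg_rat_denominator (T : Finset ℚ) : ∃ d : ℤ, d ≠ 0 ∧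
    ∀ q ∈ AddSubgroup.closure (T : Set ℚ), ∃ m : ℤ, (d : ℚ) * q = m := by
  have h1 : ∃ d : ℤ, d ≠ 0 ∧ ∀ q ∈ T, ∃ m : ℤ, (d : ℚ) * q = m := by
    classical
    induction T using Finset.induction_on with
    | empty => exact ⟨1, one_ne_zero, by simp⟩
    | insert a T _ ih =>
      obtain ⟨d, hd, h⟩ := ih
      refine ⟨d * a.den, mul_ne_zero hd (by exact_mod_cast a.den_nz), ?_⟩
      intro q hq
      rcases Finset.mem_insert.mp hq with rfl | hq
      · refine ⟨d * q.num, ?_⟩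
        push_cast
        rw [mul_assoc, Rat.den_mul_eq_num]
      · obtain ⟨m, hm⟩ := h q hq
        refine ⟨m * a.den, ?_⟩
        push_cast
        rw [← hm]; ring
  obtain ⟨d, hd, h⟩ := h1
  refine ⟨d, hd, fun q hq => ?_⟩
  induction hq using AddSubgroup.closure_induction with
  | mem x hx => exact h x hx
  | zero => exact ⟨0, by simp⟩
  | add x y _ _ hx hy =>
    obtain ⟨m, hm⟩ := hx
    obtain ⟨k, hk⟩ := hy
    exact ⟨m + k, by push_cast; rw [mul_add, hm, hk]⟩
  | neg x _ hx =>
    obtain ⟨m, hm⟩ := hx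
    exact ⟨-m, by push_cast; rw [mul_neg, hm]⟩

theorem no_bounded_denominator (d : ℤ) (hd : d ≠ 0) (q : ℚ) (hq : q ≠ 0) (m : ℤ) (hm : m ≠ 0)
    (h : ∀ j : ℤ, ∃ k : ℤ, (d : ℚ) * (q * (2 : ℚ) ^ (m * j)) = k) : False := by
  have hdq : (d : ℚ) * q ≠ 0 := mul_ne_zero (by exact_mod_cast hd) hq
  have hpos : 0 < |(d : ℚ) * q| := abs_pos.mpr hdq
  obtain ⟨N, hN⟩ := pow_unbounded_of_one_lt |(d : ℚ) * q| (by norm_num : (1 : ℚ) < 2)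
  obtain ⟨k, hk⟩ := h (-(m.sign * N))
  have h1 : m * (-(m.sign * N)) = -(|m| * N) := by
    rw [← Int.sign_mul_self_eq_abs]; ring
  rw [h1, ← mul_assoc] at hk
  have hp : (0 : ℚ) < 2 ^ (-(|m| * N : ℤ)) := zpow_pos (by norm_num) _
  have hk0 : k ≠ 0 := by
    rintro rfl
    have := mul_ne_zero hdq hp.ne'
    rw [hk] at this
    exact this (by simp)
  have h2 : (1 : ℚ) ≤ |(k : ℚ)| := by
    have := Int.one_le_abs hk0
    exact_mod_cast this
  rw [← hk, abs_mul, abs_of_pos hp] at h2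
  have h3 : (2 : ℚ) ^ (-(|m| * N : ℤ)) ≤ 2 ^ (-(N : ℤ)) := by
    apply zpow_le_zpow_right₀ (by norm_num)
    have : (1 : ℤ) ≤ |m| := Int.one_le_abs hm
    nlinarith [Int.natCast_nonneg N]
  have h4 : |(d : ℚ) * q| * 2 ^ (-(N : ℤ)) < 1 := by
    rw [zpow_neg, zpow_natCast, ← div_eq_mul_inv, div_lt_one (by positivity)]
    exact hN
  have h5 := mul_le_mul_of_nonneg_left h3 hpos.le
  linarith

/-- The unit `2 ^ m` of the rationals. -/
def twoPow (m : ℤ) : ℚˣ := (Units.mk0 (2 : ℚ) two_ne_zero) ^ m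

theorem twoPow_val (m : ℤ) : ((twoPow m : ℚˣ) : ℚ) = 2 ^ m := by simp [twoPow]

/-- The core obstruction to finite presentability. -/
theorem not_fp_core {G : Type*} [Group G] (H : Subgroup (G × G))
    (hH1 : ∀ g ∈ commutator G, (g, (1 : G)) ∈ H) (hH2 : ∀ g ∈ commutator G, ((1 : G), g) ∈ H)
    (φ₁ φ₂ : G →* HeisGrp)
    (h1 : ∀ g, (φ₁ g).y = 0 ∧ (φ₁ g).z = 0) (h2 : ∀ g, (φ₂ g).x = 0 ∧ (φ₂ g).z = 0)
    (hl : ∀ p ∈ H, (φ₁ p.1).l = (φ₂ p.2).l)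
    (g₁ g₂ : G) (hg₁ : g₁ ∈ commutator G) (hg₂ : g₂ ∈ commutator G)
    (hx : (φ₁ g₁).x ≠ 0) (hy : (φ₂ g₂).y ≠ 0) (v : G) (m : ℤ) (hm : m ≠ 0)
    (hv : (φ₁ v).l = twoPow m) (hlc : ∀ g ∈ commutator G, (φ₁ g).l = 1 ∧ (φ₂ g).l = 1)
    : ¬ FinitelyPresentedGroup H := by
  classical
  rintro ⟨n, f, R, hf, hker⟩
  let Λ : FreeGroup (Fin n) →* HeisGrp := FreeGroup.lift (fun i =>
    ⟨(φ₁ (f (FreeGroup.of i)).1.1).l, (φ₁ (f (FreeGroup.of i)).1.1).x,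
      (φ₂ (f (FreeGroup.of i)).1.2).y, 0⟩)
  have hX : HeisGrp.prX.comp Λ = ((φ₁.comp (MonoidHom.fst G G)).comp H.subtype).comp f := by
    ext1 i
    simp only [MonoidHom.comp_apply, Λ, FreeGroup.lift_apply_of]
    ext
    · rfl
    · rfl
    · exact (h1 _).1.symm
    · exact (h1 _).2.symm
  have hY : HeisGrp.prY.comp Λ = ((φ₂.comp (MonoidHom.snd G G)).comp H.subtype).comp f := by
    ext1 i
    simp only [MonoidHom.comp_apply, Λ, FreeGroup.lift_apply_of]
    ext
    · exact congrArg Units.val (hl _ (f (FreeGroup.of i)).2)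
    · exact (h2 _).1.symm
    · rfl
    · exact (h2 _).2.symm
  have hX' : ∀ w, (⟨(Λ w).l, (Λ w).x, 0, 0⟩ : HeisGrp) = φ₁ (f w).1.1 :=
    fun w => DFunLike.congr_fun hX w
  have hY' : ∀ w, (⟨(Λ w).l, 0, (Λ w).y, 0⟩ : HeisGrp) = φ₂ (f w).1.2 :=
    fun w => DFunLike.congr_fun hY w
  let T : Finset ℚ := R.image (fun r => (Λ r).z)
  let D := AddSubgroup.closure (T : Set ℚ)
  have hkerD : ∀ w, f w = 1 → (Λ w).z ∈ D := by
    have : f.ker ≤ (HeisGrp.corner D).comap Λ := by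
      rw [hker]
      apply Subgroup.normalClosure_le_normal
      intro r hr
      have hr1 : f r = 1 := by
        rw [← MonoidHom.mem_ker, hker]
        exact Subgroup.subset_normalClosure hr
      have e1 := hX' r
      have e2 := hY' r
      rw [hr1] at e1 e2
      simp only [Subgroup.coe_one, Prod.fst_one, Prod.snd_one, map_one] at e1 e2
      refine ⟨congrArg HeisGrp.l e1, congrArg HeisGrp.x e1, congrArg HeisGrp.y e2, ?_⟩
      apply AddSubgroup.subset_closure
      exact Finset.mem_coe.mpr (Finset.mem_image_of_mem _ hr)
    intro w hw
    exact (this hw).2.2.2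
  obtain ⟨d, hd, hdD⟩ := fg_rat_denominator T
  apply no_bounded_denominator d hd ((φ₁ g₁).x * (φ₂ g₂).y) (mul_ne_zero hx hy) m hm
  intro j
  have hgj : v ^ (-j) * g₁ * v ^ j ∈ commutator G := by
    have := (inferInstance : (commutator G).Normal).conj_mem g₁ hg₁ (v ^ (-j))
    simpa using this
  obtain ⟨w₁, hw₁⟩ := hf ⟨(v ^ (-j) * g₁ * v ^ j, 1), hH1 _ hgj⟩
  obtain ⟨w₂, hw₂⟩ := hf ⟨(1, g₂), hH2 _ hg₂⟩
  have a1 := hX' w₁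
  have a2 := hY' w₁
  have b1 := hX' w₂
  have b2 := hY' w₂
  rw [hw₁] at a1 a2
  rw [hw₂] at b1 b2
  simp only [map_one] at a1 a2 b1 b2
  have hxj : (φ₁ (v ^ (-j) * g₁ * v ^ j)).x = (φ₁ g₁).x * 2 ^ (m * j) := by
    have hvl : (φ₁ (v ^ j)).l = twoPow (m * j) := by
      have : ∀ a : HeisGrp, ∀ j : ℤ, (a ^ j).l = a.l ^ j := by
        intro a j
        exact map_zpow (⟨⟨HeisGrp.l, rfl⟩, fun _ _ => rfl⟩ : HeisGrp →* ℚˣ) a j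
      rw [map_zpow, this, hv, twoPow, twoPow, zpow_mul]
    rw [zpow_neg, map_mul, map_mul, map_inv, HeisGrp.mul_x, HeisGrp.mul_x, HeisGrp.inv_x, hvl,
      (hlc g₁ hg₁).1, Units.val_one]
    rw [← twoPow_val]
    have : ((twoPow (m * j))⁻¹ : ℚˣ) * ((twoPow (m * j) : ℚˣ) : ℚ) = 1 := by simp
    linear_combination (-(φ₁ (v ^ j)).x) * this
  have c1 : (Λ w₁).l = 1 := congrArg HeisGrp.l a2
  have c2 : (Λ w₁).y = 0 := congrArg HeisGrp.y a2
  have c3 : (Λ w₁).x = (φ₁ g₁).x * 2 ^ (m * j) := (congrArg HeisGrp.x a1).trans hxj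
  have d1 : (Λ w₂).l = 1 := congrArg HeisGrp.l b1
  have d2 : (Λ w₂).x = 0 := congrArg HeisGrp.x b1
  have d3 : (Λ w₂).y = (φ₂ g₂).y := by rw [← b2]
  have hcomm : f (w₁ * w₂ * w₁⁻¹ * w₂⁻¹) = 1 := by
    rw [map_mul, map_mul, map_mul, map_inv, map_inv, hw₁, hw₂]
    apply Subtype.ext
    ext <;> simp
  have hz := hkerD _ hcomm
  have hz2 : (Λ (w₁ * w₂ * w₁⁻¹ * w₂⁻¹)).z = (φ₁ g₁).x * (φ₂ g₂).y * 2 ^ (m * j) := by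
    rw [map_mul, map_mul, map_mul, map_inv, map_inv]
    simp only [HeisGrp.mul_z, HeisGrp.mul_x, HeisGrp.mul_y, HeisGrp.mul_l, HeisGrp.inv_z,
      HeisGrp.inv_x, HeisGrp.inv_y, HeisGrp.inv_l, c1, c2, c3, d1, d2, d3]
    simp
    ring
  rw [hz2] at hz
  exact hdD _ hz

theorem heis_commutator {G : Type*} [Group G] (φ : G →* HeisGrp) (a b : G)
    (h : φ a * φ b ≠ φ b * φ a) : φ ⁅a, b⁆ ≠ 1 := by
  rw [commutatorElement_def, map_mul, map_mul, map_mul, map_inv, map_inv]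
  intro h'
  apply h
  rw [mul_inv_eq_one] at h'
  exact mul_inv_eq_iff_eq_mul.mp h'

theorem necessity {V : Type*} [Fintype V] (Δ : SimpleGraph V)
    (μ : (RAAG Δ ⧸ commutator (RAAG Δ)) ≃* (RAAG Δ ⧸ commutator (RAAG Δ)))
    (hfp : FinitelyPresentedGroup
          ↥(fibreProduct (commutator (RAAG Δ)) (commutator (RAAG Δ)) μ))
    (S : Finset V) (hS : ¬ (SimpleGraph.induce ((↑S : Set V)ᶜ) Δ).Preconnected) :
    Fintype.card V ≤ 2 * S.card := by
  classical
  by_contra hcard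
  push Not at hcard
  obtain ⟨e, he⟩ : ∃ e : (RAAG Δ ⧸ commutator (RAAG Δ)) ≃* Multiplicative (V → ℤ),
      ∀ g, e (QuotientGroup.mk g) = raagAb Δ g := ⟨raagAbEquiv Δ, raagAbEquiv_mk⟩
  let co : RAAG Δ → V → ℤ := fun g => (e (μ (QuotientGroup.mk g))).toAdd
  let Lm : (V → ℤ) →ₗ[ℤ] ((S ⊕ S) → ℤ) := LinearMap.pi (Sum.elim
    (fun s => LinearMap.proj s.1) (fun s => ∑ v, (co (raagOf Δ s.1) v) • LinearMap.proj v))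
  have hninj : ¬ Function.Injective Lm := by
    intro h
    have := LinearMap.finrank_le_finrank_of_injective h
    simp at this
    omega
  obtain ⟨c, hc0, hc⟩ : ∃ c : V → ℤ, c ≠ 0 ∧ Lm c = 0 := by
    rw [← LinearMap.ker_eq_bot, Submodule.eq_bot_iff] at hninj
    push Not at hninj
    obtain ⟨c, h1, h2⟩ := hninj
    exact ⟨c, h2, h1⟩
  have hcS : ∀ s ∈ S, c s = 0 := fun s hs => congrFun hc (Sum.inl ⟨s, hs⟩)
  let χ : Multiplicative (V → ℤ) →* Multiplicative ℤ :=
    AddMonoidHom.toMultiplicative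
      { toFun := fun p => ∑ v, p v * c v
        map_zero' := by simp
        map_add' := by intro p q; simp [add_mul, Finset.sum_add_distrib] }
  have hχ : ∀ p, (χ p).toAdd = ∑ v, p.toAdd v * c v := fun p => rfl
  let χ₁ : RAAG Δ →* Multiplicative ℤ :=
    χ.comp ((e.toMonoidHom.comp μ.toMonoidHom).comp (QuotientGroup.mk' _))
  let χ₂ : RAAG Δ →* Multiplicative ℤ := χ.comp (e.toMonoidHom.comp (QuotientGroup.mk' _))
  have hχ12 : ∀ p ∈ fibreProduct (commutator (RAAG Δ)) (commutator (RAAG Δ)) μ,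
      χ₁ p.1 = χ₂ p.2 := by
    intro p hp
    have hp' : μ (QuotientGroup.mk p.1) = QuotientGroup.mk p.2 := hp
    change χ (e (μ (QuotientGroup.mk p.1))) = χ (e (QuotientGroup.mk p.2))
    rw [hp']
  let c₁ : V → ℤ := fun v => (χ₁ (raagOf Δ v)).toAdd
  have hc₁S : ∀ s ∈ S, c₁ s = 0 := by
    intro s hs
    have := congrFun hc (Sum.inr ⟨s, hs⟩)
    change (χ (e (μ (QuotientGroup.mk (raagOf Δ s))))).toAdd = 0
    rw [hχ]
    simpa [Lm, co] using this
  have hc₂ : ∀ v, (χ₂ (raagOf Δ v)).toAdd = c v := by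
    intro v
    change (χ (e (QuotientGroup.mk (raagOf Δ v)))).toAdd = c v
    rw [he, hχ, raagAb_of]
    simp [Pi.single_apply]
  have hc₁0 : c₁ ≠ 0 := by
    intro h
    have h1 : χ₁ = 1 := raag_hom_ext (fun v => by
      have := congrFun h v
      exact this)
    apply hc0
    funext v
    rw [← hc₂ v]
    obtain ⟨g, hg⟩ := QuotientGroup.mk_surjective (μ.symm (QuotientGroup.mk (raagOf Δ v)))
    have h2 : χ₁ g = χ₂ (raagOf Δ v) := by
      apply hχ12 (g, raagOf Δ v)
      change μ (QuotientGroup.mk g) = _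
      rw [hg, MulEquiv.apply_symm_apply]
    rw [← h2, h1]; rfl
  obtain ⟨x, hx, a₁, b₁, hab₁⟩ := sep_cocycle Δ S hS c₁ hc₁S hc₁0
  obtain ⟨y, hy, a₂, b₂, hab₂⟩ := sep_cocycle Δ S hS c hcS hc0
  let φ₁ : RAAG Δ →* HeisGrp := raagLift Δ (fun v => ⟨twoPow (c₁ v), x v, 0, 0⟩) (by
    intro u v huv
    have := hx u v huv
    ext
    · exact congrArg Units.val (mul_comm _ _)
    · simp only [HeisGrp.mul_x, twoPow_val]; linarith
    · simp [HeisGrp.mul_y]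
    · simp [HeisGrp.mul_z])
  let φ₂ : RAAG Δ →* HeisGrp := raagLift Δ (fun v => ⟨twoPow (c v), 0, y v, 0⟩) (by
    intro u v huv
    have := hy u v huv
    ext
    · exact congrArg Units.val (mul_comm _ _)
    · simp [HeisGrp.mul_x]
    · simp only [HeisGrp.mul_y, twoPow_val]; linarith
    · simp [HeisGrp.mul_z])
  have hφ₁ : ∀ v, φ₁ (raagOf Δ v) = ⟨twoPow (c₁ v), x v, 0, 0⟩ := raagLift_of _ _
  have hφ₂ : ∀ v, φ₂ (raagOf Δ v) = ⟨twoPow (c v), 0, y v, 0⟩ := raagLift_of _ _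
  have hp₁ : HeisGrp.prX.comp φ₁ = φ₁ := raag_hom_ext (fun v => by
    rw [MonoidHom.comp_apply, hφ₁]; rfl)
  have hp₂ : HeisGrp.prY.comp φ₂ = φ₂ := raag_hom_ext (fun v => by
    rw [MonoidHom.comp_apply, hφ₂]; rfl)
  have h1 : ∀ g, (φ₁ g).y = 0 ∧ (φ₁ g).z = 0 := fun g => by
    rw [← hp₁]; exact ⟨rfl, rfl⟩
  have h2 : ∀ g, (φ₂ g).x = 0 ∧ (φ₂ g).z = 0 := fun g => by
    rw [← hp₂]; exact ⟨rfl, rfl⟩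
  let lh : HeisGrp →* ℚˣ := ⟨⟨HeisGrp.l, rfl⟩, fun _ _ => rfl⟩
  let tp : Multiplicative ℤ →* ℚˣ := zpowersHom ℚˣ (Units.mk0 (2 : ℚ) two_ne_zero)
  have htp : ∀ m, tp m = twoPow m.toAdd := fun m => zpowersHom_apply _ _ m
  have hl₁ : lh.comp φ₁ = tp.comp χ₁ := raag_hom_ext (fun v => by
    rw [MonoidHom.comp_apply, MonoidHom.comp_apply, hφ₁, htp]; rfl)
  have hl₂ : lh.comp φ₂ = tp.comp χ₂ := raag_hom_ext (fun v => by
    rw [MonoidHom.comp_apply, MonoidHom.comp_apply, hφ₂, htp, hc₂]; rfl)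
  have hl₁' : ∀ g, (φ₁ g).l = tp (χ₁ g) := fun g => DFunLike.congr_fun hl₁ g
  have hl₂' : ∀ g, (φ₂ g).l = tp (χ₂ g) := fun g => DFunLike.congr_fun hl₂ g
  have hlc : ∀ g ∈ commutator (RAAG Δ), (φ₁ g).l = 1 ∧ (φ₂ g).l = 1 := fun g hg =>
    ⟨Abelianization.commutator_subset_ker (lh.comp φ₁) hg,
      Abelianization.commutator_subset_ker (lh.comp φ₂) hg⟩
  obtain ⟨v, hv⟩ : ∃ v, c₁ v ≠ 0 := by
    by_contra h; push Not at h; exact hc₁0 (funext h)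
  have hk₁ : ⁅raagOf Δ a₁, raagOf Δ b₁⁆ ∈ commutator (RAAG Δ) :=
    Subgroup.commutator_mem_commutator (Subgroup.mem_top _) (Subgroup.mem_top _)
  have hk₂ : ⁅raagOf Δ a₂, raagOf Δ b₂⁆ ∈ commutator (RAAG Δ) :=
    Subgroup.commutator_mem_commutator (Subgroup.mem_top _) (Subgroup.mem_top _)
  refine not_fp_core _ ?_ ?_ φ₁ φ₂ h1 h2 ?_ ⁅raagOf Δ a₁, raagOf Δ b₁⁆
    ⁅raagOf Δ a₂, raagOf Δ b₂⁆ hk₁ hk₂ ?_ ?_ (raagOf Δ v) (c₁ v) hv ?_ hlc hfp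
  · intro g hg
    change μ (QuotientGroup.mk g) = QuotientGroup.mk 1
    rw [(QuotientGroup.eq_one_iff g).mpr hg, map_one]; rfl
  · intro g hg
    change μ (QuotientGroup.mk 1) = QuotientGroup.mk g
    rw [(QuotientGroup.eq_one_iff g).mpr hg, QuotientGroup.mk_one, map_one]
  · intro p hp
    rw [hl₁', hl₂', hχ12 p hp]
  · intro h0
    refine heis_commutator φ₁ (raagOf Δ a₁) (raagOf Δ b₁) ?_ ?_
    · intro h
      have := congrArg HeisGrp.x h
      simp only [hφ₁, HeisGrp.mul_x, twoPow_val] at this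
      apply hab₁; linarith
    · ext
      · exact congrArg Units.val (hlc _ hk₁).1
      · exact h0
      · exact (h1 _).1
      · exact (h1 _).2
  · intro h0
    refine heis_commutator φ₂ (raagOf Δ a₂) (raagOf Δ b₂) ?_ ?_
    · intro h
      have := congrArg HeisGrp.y h
      simp only [hφ₂, HeisGrp.mul_y, twoPow_val] at this
      apply hab₂; linarith
    · ext
      · exact congrArg Units.val (hlc _ hk₂).2
      · exact (h2 _).1
      · exact h0
      · exact (h2 _).2
  · rw [hφ₁]

end Necessity

section GenericMatrix

variable {V : Type*} [Fintype V] [DecidableEq V]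

/-- The product of all elementary matrices with given coefficients. -/
noncomputable def elemProd (R : Type*) [CommRing R] (t : V × V → R) (l : List (V × V)) :
    Matrix V V R :=
  (l.map (fun p => (1 : Matrix V V R) + Matrix.single p.1 p.2 (t p))).prod

theorem elemProd_det (R : Type*) [CommRing R] (t : V × V → R) (l : List (V × V))
    (hl : ∀ p ∈ l, p.1 ≠ p.2) : (elemProd R t l).det = 1 := by
  induction l with
  | nil => simp [elemProd]
  | cons p l ih =>
    have h1 := hl p (by simp)
    have h2 := ih (fun q hq => hl q (by simp [hq]))
    unfold elemProd at h2 ⊢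
    rw [List.map_cons, List.prod_cons, Matrix.det_mul, h2, mul_one]
    exact Matrix.det_transvection_of_ne p.1 p.2 h1 (t p)

theorem elemProd_special (R : Type*) [CommRing R] (t : V × V → R) (l : List (V × V))
    (ht : ∀ i j k, t (i, j) * t (j, k) = 0) :
    elemProd R t l = 1 + (l.map (fun p => Matrix.single p.1 p.2 (t p))).sum := by
  induction l with
  | nil => simp [elemProd]
  | cons p l ih =>
    unfold elemProd at ih ⊢
    rw [List.map_cons, List.prod_cons, ih, List.map_cons, List.sum_cons]
    have hz : Matrix.single p.1 p.2 (t p) *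
        (l.map (fun p => Matrix.single p.1 p.2 (t p))).sum = 0 := by
      rw [← List.sum_map_mul_left]
      apply List.sum_eq_zero
      intro x hx
      simp only [List.mem_map] at hx
      obtain ⟨q, _, rfl⟩ := hx
      by_cases h : p.2 = q.1
      · rw [← h, Matrix.single_mul_single_same]
        have := ht p.1 p.2 q.2
        rw [show (p.1, p.2) = p from rfl, h, show (q.1, q.2) = q from rfl] at this
        rw [this, Matrix.single_zero]
      · exact Matrix.single_mul_single_of_ne _ _ _ _ h _
    rw [add_mul, mul_add, one_mul, mul_add, hz]
    simp only [mul_one, one_mul, add_zero]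
    abel

theorem elemProd_map {R T : Type*} [CommRing R] [CommRing T] (f : R →+* T) (t : V × V → R)
    (l : List (V × V)) : f.mapMatrix (elemProd R t l) = elemProd T (fun p => f (t p)) l := by
  unfold elemProd
  rw [map_list_prod, List.map_map]
  congr 1
  apply List.map_congr_left
  intro p _
  simp only [Function.comp_apply, map_add, map_one, RingHom.mapMatrix_apply]
  congr 1
  ext i j
  simp [Matrix.single_apply, apply_ite f]

theorem exists_generic_matrix (V : Type*) [Fintype V] [DecidableEq V] :
    ∃ M : Matrix V V ℤ, M.det = 1 ∧ ∀ (K : Finset V) (σ : K → V), Function.Injective σ →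
      (∀ i : K, σ i ∈ K → σ i = i) →
      (M.submatrix (fun i : K => (i : V)) σ).det ≠ 0 := by
  classical
  let l : List (V × V) := (Finset.univ.filter (fun p : V × V => p.1 ≠ p.2)).toList
  have hl : ∀ p ∈ l, p.1 ≠ p.2 := by intro p hp; simpa [l] using hp
  let P := MvPolynomial (V × V) ℤ
  let Φ : Matrix V V P := elemProd P (fun p => MvPolynomial.X p) l
  let Good : (Σ K : Finset V, (K → V)) → Prop := fun s =>
    Function.Injective s.2 ∧ ∀ i : s.1, s.2 i ∈ s.1 → s.2 i = i
  let dt : (Σ K : Finset V, (K → V)) → P := fun s =>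
    (Φ.submatrix (fun i : s.1 => (i : V)) s.2).det
  have hev : ∀ (t : V × V → ℤ) s, MvPolynomial.eval t (dt s) =
      ((elemProd ℤ t l).submatrix (fun i : s.1 => (i : V)) s.2).det := by
    intro t s
    simp only [dt]
    rw [RingHom.map_det, RingHom.mapMatrix_apply, ← Matrix.submatrix_map,
      ← RingHom.mapMatrix_apply, elemProd_map]
    simp
  have hne : ∀ s, Good s → dt s ≠ 0 := by
    rintro ⟨K, σ⟩ ⟨hσ, hfix⟩ h0
    simp only at hσ hfix
    let t : V × V → ℤ := fun p => if ∃ i : K, (i : V) = p.1 ∧ σ i = p.2 ∧ p.1 ≠ p.2 then 1 else 0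
    have ht : ∀ i j k, t (i, j) * t (j, k) = 0 := by
      intro i j k
      by_cases h1 : ∃ a : K, (a : V) = i ∧ σ a = j ∧ i ≠ j
      · obtain ⟨a, rfl, rfl, h3⟩ := h1
        have h2 : ¬ ∃ b : K, (b : V) = σ a ∧ σ b = k ∧ σ a ≠ k := by
          rintro ⟨b, hb, _, _⟩
          exact h3 (hfix a (hb ▸ b.2)).symm
        have h4 : t (σ a, k) = 0 := if_neg h2
        rw [h4, mul_zero]
      · have h4 : t (i, j) = 0 := if_neg h1
        rw [h4, zero_mul]
    have h1 := hev t ⟨K, σ⟩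
    rw [h0, map_zero, elemProd_special ℤ t l ht] at h1
    have h2 : ((1 + (l.map (fun p => Matrix.single p.1 p.2 (t p))).sum : Matrix V V ℤ).submatrix
        (fun i : K => (i : V)) σ) = 1 := by
      have hsum : ∀ i j : V, ((l.map (fun p => Matrix.single p.1 p.2 (t p))).sum) i j
          = t (i, j) := by
        intro i j
        simp only [l, Finset.sum_map_toList]
        rw [Matrix.sum_apply, Finset.sum_filter]
        rw [Finset.sum_eq_single (i, j)]
        · by_cases hij : i = j
          · simp [hij, t]
          · simp [hij]
        · intro p _ hp
          split_ifs
          · rw [Matrix.single_apply]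
            have : ¬ (p.1 = i ∧ p.2 = j) := fun h => hp (Prod.ext h.1 h.2)
            simp [this]
          · rfl
        · simp
      ext i j
      rw [Matrix.submatrix_apply, Matrix.add_apply, hsum, Matrix.one_apply, Matrix.one_apply]
      by_cases hij : i = j
      · subst hij
        by_cases hs : (i : V) = σ i
        · simp [← hs, t]
        · have : ∃ a : K, (a : V) = i ∧ σ a = σ i ∧ (i : V) ≠ σ i := ⟨i, rfl, rfl, hs⟩
          simp [hs, t]
      · have h3 : (i : V) ≠ σ j := by
          intro h
          have := hfix j (h ▸ i.2)
          exact hij (Subtype.ext (h.trans this))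
        have h4 : ¬ ∃ a : K, (a : V) = i ∧ σ a = σ j ∧ (i : V) ≠ σ j := by
          rintro ⟨a, ha, hb, _⟩
          exact hij ((Subtype.ext ha).symm.trans (hσ hb))
        simp only [hij, h3, t, if_false]
        rw [if_neg h4, add_zero]
    rw [h2, Matrix.det_one] at h1
    exact zero_ne_one h1
  let prodP : P := ∏ s ∈ Finset.univ.filter Good, dt s
  have hprod : prodP ≠ 0 := Finset.prod_ne_zero_iff.mpr (fun s hs => hne s (by simpa using hs))
  obtain ⟨t, ht⟩ : ∃ t : V × V → ℤ, MvPolynomial.eval t prodP ≠ 0 := by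
    by_contra h
    push Not at h
    exact hprod (MvPolynomial.funext (fun x => by rw [h x, map_zero]))
  refine ⟨elemProd ℤ t l, elemProd_det ℤ t l hl, fun K σ hσ hfix => ?_⟩
  rw [← hev t ⟨K, σ⟩]
  rw [map_prod, Finset.prod_ne_zero_iff] at ht
  exact ht ⟨K, σ⟩ (by simp only [Finset.mem_filter, Finset.mem_univ, true_and]; exact ⟨hσ, hfix⟩)

/-- A unimodular matrix whose columns together with the standard basis are in general
position. -/
theorem exists_general_position (V : Type*) [Fintype V] [DecidableEq V] :
    ∃ M : Matrix V V ℤ, M.det = 1 ∧ ∀ (I J : Finset V), Fintype.card V ≤ I.card + J.card →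
      ∀ p : V → ℤ, (∀ v ∈ I, p v = 0) → (∀ v ∈ J, ∑ i, p i * M i v = 0) → p = 0 := by
  classical
  obtain ⟨M, hM, hgen⟩ := exists_generic_matrix V
  refine ⟨M, hM, fun I J hIJ p hI hJ => ?_⟩
  obtain ⟨J', hJ', hcard⟩ : ∃ J' ⊆ J, J'.card = Iᶜ.card := by
    apply Finset.exists_subset_card_eq
    rw [Finset.card_compl]; omega
  set K := Iᶜ with hK
  have hc2 : (K \ J').card = (J' \ K).card := by
    rw [Finset.card_sdiff, Finset.card_sdiff, hcard, Finset.inter_comm]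
  let e : {x // x ∈ K \ J'} ≃ {x // x ∈ J' \ K} := Finset.equivOfCardEq hc2
  let σ : K → V := fun i => if h : (i : V) ∈ J' then i else e ⟨i, by simp [h, i.2]⟩
  have hσJ : ∀ i, σ i ∈ J' := by
    intro i
    by_cases h : (i : V) ∈ J'
    · simp [σ, h]
    · simp only [σ, h, dif_neg, not_false_eq_true]
      exact (Finset.mem_sdiff.mp (e _).2).1
  have hσfix : ∀ i : K, σ i ∈ K → σ i = i := by
    intro i hi
    by_cases h : (i : V) ∈ J'
    · simp [σ, h]
    · simp only [σ, h, dif_neg, not_false_eq_true] at hi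
      exact absurd hi (Finset.mem_sdiff.mp (e _).2).2
  have hσinj : Function.Injective σ := by
    intro i j hij
    by_cases h : (i : V) ∈ J' <;> by_cases h' : (j : V) ∈ J'
    · simp only [σ, h, h', dif_pos] at hij
      exact Subtype.ext hij
    · simp only [σ, h, h', dif_pos, dif_neg, not_false_eq_true] at hij
      exact absurd (hij ▸ i.2) (Finset.mem_sdiff.mp (e _).2).2
    · simp only [σ, h, h', dif_pos, dif_neg, not_false_eq_true] at hij
      exact absurd (hij.symm ▸ j.2) (Finset.mem_sdiff.mp (e _).2).2
    · simp only [σ, h, h', dif_neg, not_false_eq_true] at hij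
      have := e.injective (Subtype.ext hij)
      exact Subtype.ext (Subtype.mk.inj this)
  have hdet := hgen K σ hσinj hσfix
  have hv : Matrix.vecMul (fun i : K => p i) (M.submatrix (fun i : K => (i : V)) σ) = 0 := by
    ext j
    have h1 := hJ (σ j) (hJ' (hσJ j))
    simp only [Matrix.vecMul, dotProduct, Matrix.submatrix_apply, Pi.zero_apply]
    rw [← h1, Finset.sum_coe_sort K (fun i => p i * M i (σ j))]
    apply Finset.sum_subset (Finset.subset_univ _)
    intro i _ hi
    rw [hI i (by simpa [hK] using hi), zero_mul]
  have h0 := Matrix.eq_zero_of_vecMul_eq_zero hdet hv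
  funext v
  by_cases h : v ∈ I
  · exact hI v h
  · exact congrFun h0 ⟨v, by simp [hK, h]⟩

end GenericMatrix

section Darts

universe u

/-- A system of directed edges (darts) acting on an abelian group of vertices. -/
structure DartSys (Q D : Type u) [AddCommGroup Q] where
  vec : D → Q
  inv : D → D
  adj : D → D → Prop
  side : D → Bool
  vec_inv : ∀ d, vec (inv d) = - vec d
  inv_inv : ∀ d, inv (inv d) = d
  adj_symm : ∀ a b, adj a b → adj b a
  adj_inv : ∀ a b, adj a b → adj (inv a) b
  adj_side : ∀ a b, side a ≠ side b → adj a b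
  vec_ne : ∀ a, vec a ≠ 0
  vec_add_ne : ∀ a b, adj a b → vec a + vec b ≠ 0

variable {Q D : Type u} [AddCommGroup Q] {L : Type u} [Group L]

/-- A flat `L`-valued cocycle on the part of the square complex spanned by `U`. -/
structure IsCocycle (S : DartSys Q D) (U : Set Q) (B : Q → D → L) : Prop where
  inv : ∀ q a, q ∈ U → q + S.vec a ∈ U → B (q + S.vec a) (S.inv a) = (B q a)⁻¹
  flat : ∀ q a b, S.adj a b → q ∈ U → q + S.vec a ∈ U → q + S.vec b ∈ U →
    q + S.vec a + S.vec b ∈ U →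
    B (q + S.vec a) b * B q a = B (q + S.vec b) a * B q b

theorem flat_rotate (S : DartSys Q D) (B : Q → D → L) (q : Q) (a b : D)
    (h1 : B (q + S.vec a) (S.inv a) = (B q a)⁻¹)
    (h2 : B (q + S.vec b + S.vec a) (S.inv a) = (B (q + S.vec b) a)⁻¹)
    (h : B (q + S.vec a + S.vec (S.inv a)) b * B (q + S.vec a) (S.inv a) =
      B (q + S.vec a + S.vec b) (S.inv a) * B (q + S.vec a) b) :
    B (q + S.vec a) b * B q a = B (q + S.vec b) a * B q b := by
  rw [S.vec_inv, add_neg_cancel_right, h1, add_right_comm q, h2] at h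
  calc B (q + S.vec a) b * B q a
      = B (q + S.vec b) a * ((B (q + S.vec b) a)⁻¹ * B (q + S.vec a) b) * B q a := by group
    _ = B (q + S.vec b) a * B q b := by rw [← h]; group

theorem cocycle_extend (S : DartSys Q D) (U : Set Q) (B : Q → D → L) (hB : IsCocycle S U B)
    (q : Q) (hq : q ∉ U) (x : D → L)
    (hx : ∀ a b, S.adj a b → q + S.vec a ∈ U → q + S.vec b ∈ U → q + S.vec a + S.vec b ∈ U →
      B (q + S.vec a) b * x a = B (q + S.vec b) a * x b) :
    ∃ B' : Q → D → L, IsCocycle S (insert q U) B' ∧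
      (∀ p d, p ∈ U → p + S.vec d ∈ U → B' p d = B p d) ∧ ∀ d, B' q d = x d := by
  classical
  let B' : Q → D → L := fun p d =>
    if p = q then x d else if p + S.vec d = q then (x (S.inv d))⁻¹ else B p d
  have e1 : ∀ d, B' q d = x d := fun d => if_pos rfl
  have e2 : ∀ p d, p + S.vec d = q → B' p d = (x (S.inv d))⁻¹ := by
    intro p d h
    have : p ≠ q := by
      rintro rfl
      exact S.vec_ne d (by simpa using h)
    simp only [B', if_neg this, if_pos h]
  have e3 : ∀ p d, p ≠ q → p + S.vec d ≠ q → B' p d = B p d := by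
    intro p d h1 h2
    simp only [B', if_neg h1, if_neg h2]
  have hmem : ∀ p, p ∈ insert q U → p ≠ q → p ∈ U := by
    intro p hp h
    rcases hp with h' | h'
    · exact absurd h' h
    · exact h'
  have hinv : ∀ p a, p ∈ insert q U → p + S.vec a ∈ insert q U →
      B' (p + S.vec a) (S.inv a) = (B' p a)⁻¹ := by
    intro p a hp hpa
    by_cases h1 : p = q
    · subst h1
      rw [e2 _ _ (by rw [S.vec_inv, add_neg_cancel_right]), e1, S.inv_inv]
    · by_cases h2 : p + S.vec a = q
      · rw [e2 _ _ h2, h2, e1, _root_.inv_inv]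
      · rw [e3 _ _ h1 h2, e3 _ _ h2 (by rw [S.vec_inv, add_neg_cancel_right]; exact h1)]
        exact hB.inv p a (hmem _ hp h1) (hmem _ hpa h2)
  -- flatness with the new vertex at the first corner
  have f1 : ∀ a b, S.adj a b → q + S.vec a ∈ insert q U → q + S.vec b ∈ insert q U →
      q + S.vec a + S.vec b ∈ insert q U →
      B' (q + S.vec a) b * B' q a = B' (q + S.vec b) a * B' q b := by
    intro a b hab ha hb h
    have n1 : q + S.vec a ≠ q := fun h => S.vec_ne a (by simpa using h)
    have n2 : q + S.vec b ≠ q := fun h => S.vec_ne b (by simpa using h)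
    have n3 : q + S.vec a + S.vec b ≠ q := fun h => S.vec_add_ne a b hab (by
      rw [add_assoc] at h; simpa using h)
    rw [e1, e1, e3 _ _ n1 n3, e3 _ _ n2 (by rw [add_right_comm]; exact n3)]
    exact hx a b hab (hmem _ ha n1) (hmem _ hb n2) (hmem _ h n3)
  have f2 : ∀ p a b, S.adj a b → p ∈ insert q U → p + S.vec a ∈ insert q U →
      p + S.vec b ∈ insert q U → p + S.vec a + S.vec b ∈ insert q U → p + S.vec a = q →
      B' (p + S.vec a) b * B' p a = B' (p + S.vec b) a * B' p b := by
    intro p a b hab hp ha hb h hq'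
    have h' : p + S.vec b + S.vec a ∈ insert q U := by rw [add_right_comm]; exact h
    refine flat_rotate S B' p a b (hinv _ _ hp ha) (hinv _ _ hb h') ?_
    rw [hq'] at ha h ⊢
    have g1 : q + S.vec (S.inv a) = p := by rw [S.vec_inv, ← hq', add_neg_cancel_right]
    refine f1 (S.inv a) b (S.adj_inv _ _ hab) ?_ h ?_
    · rw [g1]; exact hp
    · rw [g1]; exact hb
  have f3 : ∀ p a b, S.adj a b → p ∈ insert q U → p + S.vec a ∈ insert q U →
      p + S.vec b ∈ insert q U → p + S.vec a + S.vec b ∈ insert q U → p + S.vec b = q →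
      B' (p + S.vec a) b * B' p a = B' (p + S.vec b) a * B' p b := by
    intro p a b hab hp ha hb h hq'
    exact (f2 p b a (S.adj_symm _ _ hab) hp hb ha (by rw [add_right_comm]; exact h) hq').symm
  refine ⟨B', ⟨hinv, ?_⟩, ?_, e1⟩
  · intro p a b hab hp ha hb h
    by_cases c1 : p = q
    · subst c1; exact f1 a b hab ha hb h
    by_cases c2 : p + S.vec a = q
    · exact f2 p a b hab hp ha hb h c2
    by_cases c3 : p + S.vec b = q
    · exact f3 p a b hab hp ha hb h c3
    have h' : p + S.vec b + S.vec a ∈ insert q U := by rw [add_right_comm]; exact h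
    by_cases c4 : p + S.vec a + S.vec b = q
    · refine flat_rotate S B' p a b (hinv _ _ hp ha) (hinv _ _ hb h') ?_
      have g1 : p + S.vec a + S.vec (S.inv a) = p := by rw [S.vec_inv, add_neg_cancel_right]
      exact f3 (p + S.vec a) (S.inv a) b (S.adj_inv _ _ hab) ha (by rw [g1]; exact hp) h
        (by rw [g1]; exact hb) c4
    · rw [e3 _ _ c2 c4, e3 _ _ c1 c2, e3 _ _ c3 (by rw [add_right_comm]; exact c4), e3 _ _ c1 c3]
      exact hB.flat p a b hab (hmem _ hp c1) (hmem _ ha c2) (hmem _ hb c3) (hmem _ h c4)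
  · intro p d hp hpd
    exact e3 p d (fun h => hq (h ▸ hp)) (fun h => hq (h ▸ hpd))

/-- Conditions at a new vertex `q` which make extension of cocycles possible and unique. -/
structure GoodAt (S : DartSys Q D) (U : Set Q) (q : Q) (z : D) (s : Bool) (c0 : D)
    (St : D → Prop) : Prop where
  st1 : ∀ d, St d → q + S.vec d ∈ U
  st2 : ∀ d a, St d → q + S.vec a ∈ U → q + S.vec a + S.vec d ∈ U
  st3 : ∀ d a b, St d → q + S.vec a + S.vec b ∈ U → q + S.vec a + S.vec b + S.vec d ∈ U
  z_st : St z
  z_side : S.side z ≠ s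
  c_st : St c0
  c_side : S.side c0 = s
  conn : ∀ P : D → Prop, P c0 → (∀ a b, St a → St b → S.side a = s → S.side b = s →
    S.adj a b → P a → P b) → ∀ c, St c → S.side c = s → P c
  dom : ∀ d, S.side d = s → ∃ a, St a ∧ S.side a = s ∧ S.adj a d

/-- Transition element in the link of `q`. -/
def linkT (S : DartSys Q D) (B : Q → D → L) (q : Q) (a b : D) : L :=
  (B (q + S.vec b) a)⁻¹ * B (q + S.vec a) b

theorem linkT_inv (S : DartSys Q D) (B : Q → D → L) (q : Q) (a b : D) :
    linkT S B q b a = (linkT S B q a b)⁻¹ := by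
  simp [linkT]

theorem linkT_triangle (S : DartSys Q D) (U : Set Q) (B : Q → D → L) (hB : IsCocycle S U B)
    (q : Q) (a b c : D) (hab : S.adj a b) (hac : S.adj a c) (hbc : S.adj b c)
    (ha : q + S.vec a ∈ U) (hb : q + S.vec b ∈ U) (hc : q + S.vec c ∈ U)
    (h1 : q + S.vec a + S.vec b ∈ U) (h2 : q + S.vec a + S.vec c ∈ U)
    (h3 : q + S.vec b + S.vec c ∈ U) (h4 : q + S.vec a + S.vec b + S.vec c ∈ U) :
    linkT S B q b c * linkT S B q a b = linkT S B q a c := by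
  have s1 := hB.flat (q + S.vec a) b c hbc ha h1 h2 h4
  have s2 := hB.flat (q + S.vec b) a c hac hb (by rwa [add_right_comm]) h3
    (by rwa [add_right_comm q])
  have s3 := hB.flat (q + S.vec c) a b hab hc (by rwa [add_right_comm])
    (by rwa [add_right_comm]) (by rwa [add_right_comm q, add_right_comm (q + S.vec a)])
  rw [add_right_comm q (S.vec b) (S.vec a)] at s2
  rw [add_right_comm q (S.vec c) (S.vec a), add_right_comm q (S.vec c) (S.vec b)] at s3
  unfold linkT
  have t2 : B (q + S.vec b) c * (B (q + S.vec b) a)⁻¹ =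
      (B (q + S.vec b + S.vec c) a)⁻¹ * B (q + S.vec a + S.vec b) c := by
    rw [mul_inv_eq_iff_eq_mul, mul_assoc, s2]; group
  have t1 : B (q + S.vec a) b = (B (q + S.vec a + S.vec b) c)⁻¹ *
      (B (q + S.vec a + S.vec c) b * B (q + S.vec a) c) := by rw [← s1]; group
  have t3 : (B (q + S.vec c) b)⁻¹ * (B (q + S.vec b + S.vec c) a)⁻¹ *
      B (q + S.vec a + S.vec c) b = (B (q + S.vec c) a)⁻¹ := by
    rw [← mul_inv_rev, ← s3]; group
  calc (B (q + S.vec c) b)⁻¹ * B (q + S.vec b) c * ((B (q + S.vec b) a)⁻¹ * B (q + S.vec a) b)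
      = (B (q + S.vec c) b)⁻¹ * (B (q + S.vec b) c * (B (q + S.vec b) a)⁻¹) *
          B (q + S.vec a) b := by group
    _ = (B (q + S.vec c) b)⁻¹ * (B (q + S.vec b + S.vec c) a)⁻¹ *
          B (q + S.vec a + S.vec c) b * B (q + S.vec a) c := by rw [t2, t1]; group
    _ = _ := by rw [t3]

theorem link_solution (S : DartSys Q D) (U : Set Q) (B : Q → D → L) (hB : IsCocycle S U B)
    (q : Q) (z : D) (s : Bool) (c0 : D) (St : D → Prop) (hg : GoodAt S U q z s c0 St) :
    ∃ x : D → L, x z = 1 ∧ ∀ a b, S.adj a b → q + S.vec a ∈ U → q + S.vec b ∈ U →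
      q + S.vec a + S.vec b ∈ U → B (q + S.vec a) b * x a = B (q + S.vec b) a * x b := by
  classical
  have tri : ∀ a b c, St a → S.adj a b → S.adj a c → S.adj b c → q + S.vec b ∈ U →
      q + S.vec c ∈ U → q + S.vec b + S.vec c ∈ U →
      linkT S B q b c * linkT S B q a b = linkT S B q a c := by
    intro a b c ha hab hac hbc hb hc h
    refine linkT_triangle S U B hB q a b c hab hac hbc (hg.st1 a ha) hb hc ?_ ?_ h ?_
    · rw [add_right_comm]; exact hg.st2 a b ha hb
    · rw [add_right_comm]; exact hg.st2 a c ha hc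
    · rw [add_right_comm q, add_right_comm (q + S.vec b)]; exact hg.st3 a b c ha h
  have hne : ∀ {a b : D}, S.side a = s → S.side b ≠ s → S.adj a b := by
    intro a b h1 h2
    exact S.adj_side _ _ (by rw [h1]; exact h2.symm)
  have hne' : ∀ {a b : D}, S.side a = s → S.side b ≠ s → S.adj b a := by
    intro a b h1 h2
    exact S.adj_symm _ _ (hne h1 h2)
  -- independence of the choice of base dart
  have indep : ∀ d, S.side d ≠ s → q + S.vec d ∈ U → ∀ c, St c → S.side c = s →
      linkT S B q c d * linkT S B q z c = linkT S B q c0 d * linkT S B q z c0 := by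
    intro d hd hdU
    apply hg.conn (fun c => linkT S B q c d * linkT S B q z c =
      linkT S B q c0 d * linkT S B q z c0) rfl
    intro a b ha hb sa sb hab h
    rw [← h]
    have t1 := tri z a b hg.z_st (hne' sa hg.z_side) (hne' sb hg.z_side) hab (hg.st1 a ha)
      (hg.st1 b hb) (hg.st2 b a hb (hg.st1 a ha))
    have t2 := tri a b d ha hab (hne sa hd) (hne sb hd) (hg.st1 b hb) hdU
      (by rw [add_right_comm]; exact hg.st2 b d hb hdU)
    rw [← t1, ← t2]
    group
  let x : D → L := fun d => if S.side d = s then linkT S B q z d else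
    linkT S B q c0 d * linkT S B q z c0
  have x1 : ∀ d, S.side d = s → x d = linkT S B q z d := fun d h => if_pos h
  have x2 : ∀ d, S.side d ≠ s → x d = linkT S B q c0 d * linkT S B q z c0 := fun d h => if_neg h
  have mixed : ∀ a b, S.side a = s → S.side b ≠ s → q + S.vec a ∈ U → q + S.vec b ∈ U →
      q + S.vec a + S.vec b ∈ U → x b = linkT S B q a b * x a := by
    intro a b sa sb ha hb h
    obtain ⟨w, hw, sw, hwa⟩ := hg.dom a sa
    rw [x1 a sa, x2 b sb, ← indep b sb hb w hw sw]
    have t1 := tri z w a hg.z_st (hne' sw hg.z_side) (hne' sa hg.z_side) hwa (hg.st1 w hw) ha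
      (by rw [add_right_comm]; exact hg.st2 w a hw ha)
    have t2 := tri w a b hw hwa (hne sw sb) (hne sa sb) ha hb h
    rw [← t1, ← t2]
    group
  refine ⟨x, ?_, ?_⟩
  · rw [x2 z hg.z_side, linkT_inv]; group
  · intro a b hab ha hb h
    have key : x b = linkT S B q a b * x a := by
      by_cases sa : S.side a = s <;> by_cases sb : S.side b = s
      · rw [x1 a sa, x1 b sb]
        exact (tri z a b hg.z_st (hne' sa hg.z_side) (hne' sb hg.z_side) hab ha hb h).symm
      · exact mixed a b sa sb ha hb h
      · have := mixed b a sb sa hb ha (by rw [add_right_comm]; exact h)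
        rw [this, linkT_inv]; group
      · rw [x2 a sa, x2 b sb, ← mul_assoc]
        rw [tri c0 a b hg.c_st (hne hg.c_side sa) (hne hg.c_side sb) hab ha hb h]
    rw [key, linkT]
    group

/-- One-vertex extension. -/
theorem dart_extend_one (S : DartSys Q D) (U : Set Q) (B : Q → D → L) (hB : IsCocycle S U B)
    (q : Q) (hq : q ∉ U) (z : D) (hg : ∃ s c0 St, GoodAt S U q z s c0 St) :
    ∃ B' : Q → D → L, IsCocycle S (insert q U) B' ∧
      (∀ p d, p ∈ U → p + S.vec d ∈ U → B' p d = B p d) ∧ B' q z = 1 := by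
  obtain ⟨s, c0, St, hg⟩ := hg
  obtain ⟨x, hz, hx⟩ := link_solution S U B hB q z s c0 St hg
  obtain ⟨B', h1, h2, h3⟩ := cocycle_extend S U B hB q hq x hx
  exact ⟨B', h1, h2, by rw [h3, hz]⟩

theorem dart_unique_one (S : DartSys Q D) (U : Set Q) (A A' : Q → D → L)
    (hA : IsCocycle S Set.univ A) (hA' : IsCocycle S Set.univ A')
    (q : Q) (z : D) (hg : ∃ s c0 St, GoodAt S U q z s c0 St)
    (heq : ∀ p d, p ∈ U → p + S.vec d ∈ U → A p d = A' p d) (hz : A q z = A' q z) :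
    ∀ d, q + S.vec d ∈ U → A q d = A' q d := by
  obtain ⟨s, c0, St, hg⟩ := hg
  have step : ∀ a b, S.adj a b → q + S.vec a ∈ U → q + S.vec b ∈ U →
      q + S.vec a + S.vec b ∈ U → A q a = A' q a → A q b = A' q b := by
    intro a b hab ha hb h e
    have f := hA.flat q a b hab trivial trivial trivial trivial
    have f' := hA'.flat q a b hab trivial trivial trivial trivial
    rw [e, heq _ _ ha h, heq _ _ hb (by rwa [add_right_comm]), f'] at f
    exact (mul_left_cancel f).symm
  have hs : ∀ d, S.side d = s → q + S.vec d ∈ U → A q d = A' q d := by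
    intro d sd hd
    exact step z d (S.adj_side _ _ (by rw [sd]; exact hg.z_side)) (hg.st1 z hg.z_st) hd
      (by rw [add_right_comm]; exact hg.st2 z d hg.z_st hd) hz
  intro d hd
  by_cases sd : S.side d = s
  · exact hs d sd hd
  · exact step c0 d (S.adj_side _ _ (by rw [hg.c_side]; exact fun h => sd h.symm))
      (hg.st1 _ hg.c_st) hd (by rw [add_right_comm]; exact hg.st2 c0 d hg.c_st hd)
      (hs c0 hg.c_side (hg.st1 _ hg.c_st))

theorem dart_extend_all (S : DartSys Q D) (r : Q → ℕ) (hr : Function.Injective r) (k0 : ℕ)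
    (z : Q → D) (hg : ∀ q, k0 ≤ r q → ∃ s c0 St, GoodAt S {p | r p < r q} q (z q) s c0 St)
    (B : Q → D → L) (hB : IsCocycle S {p | r p < k0} B) :
    ∃ A : Q → D → L, IsCocycle S Set.univ A ∧
      (∀ p d, r p < k0 → r (p + S.vec d) < k0 → A p d = B p d) ∧
      ∀ q, k0 ≤ r q → A q (z q) = 1 := by
  classical
  have step : ∀ (j : ℕ) (C : {C : Q → D → L // IsCocycle S {p | r p < k0 + j} C}),
      ∃ C' : {C : Q → D → L // IsCocycle S {p | r p < k0 + (j + 1)} C},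
        (∀ p d, r p < k0 + j → r (p + S.vec d) < k0 + j → C'.1 p d = C.1 p d) ∧
        ∀ q, r q = k0 + j → C'.1 q (z q) = 1 := by
    rintro j ⟨C, hC⟩
    by_cases h : ∃ q, r q = k0 + j
    · obtain ⟨q, hq⟩ := h
      have hg' := hg q (by omega)
      rw [hq] at hg'
      obtain ⟨C', h1, h2, h3⟩ := dart_extend_one S {p | r p < k0 + j} C hC q
        (by simp [hq]) (z q) hg'
      have hU : insert q {p | r p < k0 + j} = {p | r p < k0 + (j + 1)} := by
        ext p
        simp only [Set.mem_insert_iff, Set.mem_ofPred_eq]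
        constructor
        · rintro (rfl | h) <;> omega
        · intro h
          by_cases hp : r p = k0 + j
          · left; exact hr (hp.trans hq.symm)
          · right; omega
      rw [hU] at h1
      refine ⟨⟨C', h1⟩, h2, ?_⟩
      intro q' hq'
      rw [hr (hq'.trans hq.symm)]
      exact h3
    · have hU : {p | r p < k0 + j} = {p | r p < k0 + (j + 1)} := by
        ext p
        simp only [Set.mem_ofPred_eq]
        constructor
        · intro; omega
        · intro h'
          by_contra h''
          exact h ⟨p, by omega⟩
      refine ⟨⟨C, hU ▸ hC⟩, fun _ _ _ _ => rfl, fun q hq => absurd ⟨q, hq⟩ h⟩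
  choose nxt hn1 hn2 using step
  let sq : (j : ℕ) → {C : Q → D → L // IsCocycle S {p | r p < k0 + j} C} :=
    fun j => Nat.rec (motive := fun j => {C : Q → D → L // IsCocycle S {p | r p < k0 + j} C})
      ⟨B, by simpa using hB⟩ (fun j C => nxt j C) j
  let fn : ℕ → Q → D → L := fun j => (sq j).1
  have sq0 : (sq 0).1 = B := rfl
  have sqs : ∀ j, sq (j + 1) = nxt j (sq j) := fun j => rfl
  have mono : ∀ i j, ∀ p d, r p < k0 + j → r (p + S.vec d) < k0 + j →
      fn (j + i) p d = fn j p d := by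
    intro i j p d h1 h2
    induction i with
    | zero => rfl
    | succ i ih =>
      exact (hn1 (j + i) (sq (j + i)) p d (by omega) (by omega)).trans ih
  let A : Q → D → L := fun q d => (sq (r q + r (q + S.vec d) + 1)).1 q d
  have hA : ∀ j p d, r p < k0 + j → r (p + S.vec d) < k0 + j → A p d = (sq j).1 p d := by
    intro j p d h1 h2
    have e1 := mono (r p + r (p + S.vec d) + 1) j p d h1 h2
    have e2 := mono j (r p + r (p + S.vec d) + 1) p d (by omega) (by omega)
    rw [add_comm] at e2
    exact e2.symm.trans e1
  refine ⟨A, ⟨?_, ?_⟩, ?_, ?_⟩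
  · intro q a _ _
    have hi : q + S.vec a + S.vec (S.inv a) = q := by rw [S.vec_inv, add_neg_cancel_right]
    have m1 : r q < k0 + (r q + r (q + S.vec a) + 1) := by omega
    have m2 : r (q + S.vec a) < k0 + (r q + r (q + S.vec a) + 1) := by omega
    rw [hA _ q a m1 m2, hA _ (q + S.vec a) (S.inv a) m2 (by rw [hi]; exact m1)]
    exact (sq _).2.inv q a m1 m2
  · intro q a b hab _ _ _ _
    obtain ⟨j, m1, m2, m3, m4⟩ : ∃ j, r q < k0 + j ∧ r (q + S.vec a) < k0 + j ∧
        r (q + S.vec b) < k0 + j ∧ r (q + S.vec a + S.vec b) < k0 + j :=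
      ⟨r q + r (q + S.vec a) + r (q + S.vec b) + r (q + S.vec a + S.vec b) + 1,
        by omega, by omega, by omega, by omega⟩
    rw [hA j _ _ m2 m4, hA j _ _ m1 m2, hA j _ _ m3 (by rw [add_right_comm]; exact m4),
      hA j _ _ m1 m3]
    exact (sq j).2.flat q a b hab m1 m2 m3 m4
  · intro p d h1 h2
    rw [hA 0 p d h1 h2, sq0]
  · intro q hq
    obtain ⟨j, hj⟩ := Nat.exists_eq_add_of_le hq
    obtain ⟨s, c0, St, hgq⟩ := hg q hq
    have h1 : r (q + S.vec (z q)) < r q := hgq.st1 _ hgq.z_st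
    rw [hA (j + 1) q (z q) (by omega) (by omega), sqs]
    exact hn2 j _ q hj

theorem dart_unique_all (S : DartSys Q D) (r : Q → ℕ) (hr : Function.Injective r) (k0 : ℕ)
    (z : Q → D) (hg : ∀ q, k0 ≤ r q → ∃ s c0 St, GoodAt S {p | r p < r q} q (z q) s c0 St)
    (A A' : Q → D → L) (hA : IsCocycle S Set.univ A) (hA' : IsCocycle S Set.univ A')
    (h0 : ∀ p d, r p < k0 → r (p + S.vec d) < k0 → A p d = A' p d)
    (h1 : ∀ q, k0 ≤ r q → A q (z q) = A' q (z q)) : ∀ p d, A p d = A' p d := by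
  have main : ∀ j p d, r p < k0 + j → r (p + S.vec d) < k0 + j → A p d = A' p d := by
    intro j
    induction j with
    | zero => exact h0
    | succ j ih =>
      have new : ∀ p d, r p = k0 + j → r (p + S.vec d) < k0 + j → A p d = A' p d := by
        intro p d hp hd
        refine dart_unique_one S {p' | r p' < r p} A A' hA hA' p (z p) (hg p (by omega)) ?_
          (h1 p (by omega)) d (by simpa [hp] using hd)
        intro p' d' hp' hd'
        rw [hp] at hp' hd'
        exact ih p' d' hp' hd'
      intro p d hp hd
      by_cases c1 : r p = k0 + j
      · apply new p d c1
        have : r (p + S.vec d) ≠ r p := fun h => S.vec_ne d (by simpa using hr h)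
        omega
      · by_cases c2 : r (p + S.vec d) = k0 + j
        · have e1 := hA.inv p d trivial trivial
          have e2 := hA'.inv p d trivial trivial
          rw [new _ (S.inv d) c2 (by rw [S.vec_inv, add_neg_cancel_right]; omega), e2] at e1
          exact (inv_injective e1).symm
        · exact ih p d (by omega) (by omega)
  intro p d
  exact main (r p + r (p + S.vec d) + 1) p d (by omega) (by omega)

/-- The twisted product of `Q` with functions on `Q`. -/
structure Tw (Q L : Type u) where
  c : Q
  b : Q → L

theorem Tw.ext_of {x y : Tw Q L} (h1 : x.c = y.c) (h2 : ∀ q, x.b q = y.b q) : x = y := by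
  cases x; cases y
  simp only at h1 h2
  subst h1
  congr
  exact funext h2

instance : Mul (Tw Q L) := ⟨fun x y => ⟨x.c + y.c, fun q => x.b (q + y.c) * y.b q⟩⟩
instance : One (Tw Q L) := ⟨⟨0, fun _ => 1⟩⟩
instance : Inv (Tw Q L) := ⟨fun x => ⟨-x.c, fun q => (x.b (q - x.c))⁻¹⟩⟩

theorem Tw.mul_c (x y : Tw Q L) : (x * y).c = x.c + y.c := rfl
theorem Tw.mul_b (x y : Tw Q L) (q : Q) : (x * y).b q = x.b (q + y.c) * y.b q := rfl
theorem Tw.one_c : (1 : Tw Q L).c = 0 := rfl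
theorem Tw.one_b (q : Q) : (1 : Tw Q L).b q = 1 := rfl
theorem Tw.inv_c (x : Tw Q L) : (x⁻¹).c = -x.c := rfl
theorem Tw.inv_b (x : Tw Q L) (q : Q) : (x⁻¹).b q = (x.b (q - x.c))⁻¹ := rfl

instance : Group (Tw Q L) :=
  Group.ofLeftAxioms
    (by
      intro x y w
      apply Tw.ext_of
      · simp [Tw.mul_c, add_assoc]
      · intro q
        simp only [Tw.mul_b, Tw.mul_c, mul_assoc]
        rw [add_comm y.c, ← add_assoc])
    (by
      intro x
      apply Tw.ext_of
      · simp [Tw.mul_c, Tw.one_c]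
      · intro q; simp [Tw.mul_b, Tw.one_b])
    (by
      intro x
      apply Tw.ext_of
      · simp [Tw.mul_c, Tw.one_c, Tw.inv_c]
      · intro q; simp [Tw.mul_b, Tw.one_b, Tw.inv_b])

end Darts

section DartsFP

universe u

variable {Q D : Type u} [AddCommGroup Q] {Γ : Type u} [Group Γ]

open Classical in
/-- A section adapted to the tree of parent edges. -/
noncomputable def tauSec (S : DartSys Q D) (r : Q → ℕ) (k0 : ℕ) (z : Q → D) (gen : D → Γ)
    (σ : Q → Γ) (q : Q) : Γ :=
  if r q < k0 then (if q = 0 then 1 else σ q)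
  else if h : r (q + S.vec (z q)) < r q then
    (gen (z q))⁻¹ * tauSec S r k0 z gen σ (q + S.vec (z q))
  else 1
termination_by r q

/-- A group acting suitably on a square complex with good links has a finitely presented
kernel. -/
theorem fp_of_darts [Finite D] (S : DartSys Q D) (r : Q → ℕ) (hr : Function.Injective r) (k0 : ℕ)
    (hr0 : r 0 < k0)
    (z : Q → D) (hg : ∀ q, k0 ≤ r q → ∃ s c0 St, GoodAt S {p | r p < r q} q (z q) s c0 St)
    (gen : D → Γ) (hginv : ∀ a, gen (S.inv a) = (gen a)⁻¹)
    (hgcomm : ∀ a b, S.adj a b → gen a * gen b = gen b * gen a)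
    (hgen : Subgroup.closure (Set.range gen) = ⊤)
    (hlift : ∀ (T : Type u) [Group T] (t : D → T), (∀ a, t (S.inv a) = (t a)⁻¹) →
      (∀ a b, S.adj a b → t a * t b = t b * t a) → ∃ Φ : Γ →* T, ∀ a, Φ (gen a) = t a)
    (π : Γ →* Multiplicative Q) (hπ : ∀ a, π (gen a) = Multiplicative.ofAdd (S.vec a))
    (hπs : Function.Surjective π) : FinitelyPresentedGroup π.ker := by
  classical
  choose σ hσ using fun q : Q => hπs (Multiplicative.ofAdd q)
  let τ : Q → Γ := tauSec S r k0 z gen σ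
  have hdesc : ∀ q, k0 ≤ r q → r (q + S.vec (z q)) < r q := by
    intro q hq
    obtain ⟨s, c0, St, h⟩ := hg q hq
    exact h.st1 _ h.z_st
  have τ0 : τ 0 = 1 := by
    simp only [τ]; rw [tauSec, if_pos hr0, if_pos rfl]
  have τz : ∀ q, k0 ≤ r q → τ q = (gen (z q))⁻¹ * τ (q + S.vec (z q)) := by
    intro q hq
    simp only [τ]
    rw [tauSec, if_neg (by omega), dif_pos (hdesc q hq)]
  have τπ : ∀ q, π (τ q) = Multiplicative.ofAdd q := by
    have : ∀ n q, r q = n → π (τ q) = Multiplicative.ofAdd q := by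
      intro n
      induction n using Nat.strong_induction_on with
      | _ n ih =>
        intro q hq
        by_cases h : r q < k0
        · simp only [τ]
          rw [tauSec, if_pos h]
          split_ifs with h0
          · rw [h0, map_one]; rfl
          · exact hσ q
        · rw [τz q (by omega), map_mul, map_inv, hπ,
            ih _ (hq ▸ hdesc q (by omega)) _ rfl, ← ofAdd_neg, ← ofAdd_add]
          congr 1
          abel
    intro q
    exact this _ q rfl
  let β : Q → D → π.ker := fun q a => ⟨(τ (q + S.vec a))⁻¹ * gen a * τ q, by
    rw [MonoidHom.mem_ker, map_mul, map_mul, map_inv, τπ, τπ, hπ, ← ofAdd_neg, ← ofAdd_add,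
      ← ofAdd_add]
    rw [show -(q + S.vec a) + S.vec a + q = 0 by abel]
    rfl⟩
  have hβ : IsCocycle S Set.univ β := by
    refine ⟨?_, ?_⟩
    · intro q a _ _
      apply Subtype.ext
      simp only [β, InvMemClass.coe_inv, S.vec_inv, add_neg_cancel_right, hginv]
      group
    · intro q a b hab _ _ _ _
      apply Subtype.ext
      simp only [β, Subgroup.coe_mul]
      rw [add_right_comm q (S.vec b)]
      have := hgcomm a b hab
      calc _ = (τ (q + S.vec a + S.vec b))⁻¹ * (gen b * gen a) * τ q := by group
        _ = _ := by rw [← this]; group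
  have hβz : ∀ q, k0 ≤ r q → β q (z q) = 1 := by
    intro q hq
    apply Subtype.ext
    simp only [β, Subgroup.coe_one]
    rw [τz q hq]; group
  -- the finite presentation
  have hfin : Finite {q // r q < k0} :=
    Finite.of_injective (fun q : {q // r q < k0} => (⟨r q.1, q.2⟩ : Fin k0))
      (fun a b h => Subtype.ext (hr (by simpa using h)))
  let X : Type u := {q // r q < k0} × D
  let w : Q → D → FreeGroup X := fun q a => if h : r q < k0 then FreeGroup.of (⟨q, h⟩, a) else 1
  let R1 : Set (FreeGroup X) := {y | ∃ q a, r q < k0 ∧ r (q + S.vec a) < k0 ∧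
    y = w (q + S.vec a) (S.inv a) * w q a}
  let R2 : Set (FreeGroup X) := {y | ∃ q a b, S.adj a b ∧ r q < k0 ∧ r (q + S.vec a) < k0 ∧
    r (q + S.vec b) < k0 ∧ r (q + S.vec a + S.vec b) < k0 ∧
    y = w (q + S.vec a) b * w q a * (w (q + S.vec b) a * w q b)⁻¹}
  let R : Set (FreeGroup X) := R1 ∪ R2
  have hR : R.Finite := by
    apply Set.Finite.union
    · apply (Set.finite_range (fun x : {q // r q < k0} × D =>
        w (x.1.1 + S.vec x.2) (S.inv x.2) * w x.1.1 x.2)).subset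
      rintro y ⟨q, a, h, _, rfl⟩
      exact ⟨(⟨q, h⟩, a), rfl⟩
    · apply (Set.finite_range (fun x : {q // r q < k0} × D × D =>
        w (x.1.1 + S.vec x.2.1) x.2.2 * w x.1.1 x.2.1 *
          (w (x.1.1 + S.vec x.2.2) x.2.1 * w x.1.1 x.2.2)⁻¹)).subset
      rintro y ⟨q, a, b, _, h, _, _, _, rfl⟩
      exact ⟨(⟨q, h⟩, a, b), rfl⟩
  let F : FreeGroup X →* π.ker := FreeGroup.lift (fun x => β x.1.1 x.2)
  have hF : ∀ q a, r q < k0 → F (w q a) = β q a := by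
    intro q a h
    simp only [F, w, dif_pos h, FreeGroup.lift_apply_of]
  have hrel : ∀ y ∈ R, FreeGroup.lift (fun x : X => β x.1.1 x.2) y = 1 := by
    change ∀ y ∈ R, F y = 1
    rintro y (⟨q, a, h1, h2, rfl⟩ | ⟨q, a, b, hab, h1, h2, h3, h4, rfl⟩)
    · rw [map_mul, hF _ _ h1, hF _ _ h2, hβ.inv q a trivial trivial, inv_mul_cancel]
    · rw [map_mul, map_inv, map_mul, map_mul, hF _ _ h2, hF _ _ h1, hF _ _ h3, hF _ _ h1,
        hβ.flat q a b hab trivial trivial trivial trivial, mul_inv_cancel]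
  let f : PresentedGroup R →* π.ker := PresentedGroup.toGroup hrel
  let B : Q → D → PresentedGroup R := fun q a => PresentedGroup.mk R (w q a)
  have hfB : ∀ q a, r q < k0 → f (B q a) = β q a := by
    intro q a h
    rw [← hF q a h]
    rfl
  have hB : IsCocycle S {p | r p < k0} B := by
    refine ⟨?_, ?_⟩
    · intro q a h1 h2
      have : PresentedGroup.mk R (w (q + S.vec a) (S.inv a) * w q a) = 1 :=
        PresentedGroup.one_of_mem (Or.inl ⟨q, a, h1, h2, rfl⟩)
      rw [map_mul] at this
      exact eq_inv_of_mul_eq_one_left this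
    · intro q a b hab h1 h2 h3 h4
      have : PresentedGroup.mk R (w (q + S.vec a) b * w q a * (w (q + S.vec b) a * w q b)⁻¹) = 1 :=
        PresentedGroup.one_of_mem (Or.inr ⟨q, a, b, hab, h1, h2, h3, h4, rfl⟩)
      rw [map_mul, map_inv, mul_inv_eq_one, map_mul, map_mul] at this
      exact this
  obtain ⟨A, hA, hA0, hAz⟩ := dart_extend_all S r hr k0 z hg B hB
  have hfA : ∀ q a, f (A q a) = β q a := by
    refine dart_unique_all S r hr k0 z hg (fun q a => f (A q a)) β ?_ hβ ?_ ?_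
    · refine ⟨?_, ?_⟩
      · intro q a _ _
        rw [hA.inv q a trivial trivial, map_inv]
      · intro q a b hab _ _ _ _
        rw [← map_mul, ← map_mul, hA.flat q a b hab trivial trivial trivial trivial]
    · intro p d h1 h2
      rw [hA0 p d h1 h2, hfB p d h1]
    · intro q hq
      rw [hAz q hq, hβz q hq, map_one]
  obtain ⟨Φ, hΦ⟩ := hlift (Tw Q (PresentedGroup R)) (fun a => ⟨S.vec a, fun q => A q a⟩) (by
      intro a
      apply Tw.ext_of
      · exact S.vec_inv a
      · intro q
        rw [Tw.inv_b]
        simp only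
        have := hA.inv (q - S.vec a) a trivial trivial
        rwa [sub_add_cancel] at this) (by
      intro a b hab
      apply Tw.ext_of
      · rw [Tw.mul_c, Tw.mul_c, add_comm]
      · intro q
        rw [Tw.mul_b, Tw.mul_b]
        exact (hA.flat q a b hab trivial trivial trivial trivial).symm)
  have hmem : ∀ g : Γ, g ∈ Subgroup.closure (Set.range gen) := by
    intro g; rw [hgen]; trivial
  have key : ∀ g : Γ, (Φ g).c = (π g).toAdd ∧
      ∀ q, ((f ((Φ g).b q) : π.ker) : Γ) = (τ (q + (π g).toAdd))⁻¹ * g * τ q := by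
    intro g
    induction hmem g using Subgroup.closure_induction with
    | mem x hx =>
      obtain ⟨a, rfl⟩ := hx
      rw [hΦ, hπ]
      refine ⟨rfl, fun q => ?_⟩
      simp only [hfA]
      rfl
    | one =>
      rw [map_one, map_one]
      refine ⟨rfl, fun q => ?_⟩
      rw [Tw.one_b, map_one]
      simp
    | mul x y _ _ hx hy =>
      rw [map_mul, map_mul]
      refine ⟨?_, fun q => ?_⟩
      · rw [Tw.mul_c, hx.1, hy.1]; rfl
      · rw [Tw.mul_b, map_mul, Subgroup.coe_mul, hx.2, hy.2, hy.1, toAdd_mul,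
          add_comm (π x).toAdd, ← add_assoc]
        group
    | inv x _ hx =>
      rw [map_inv, map_inv]
      refine ⟨?_, fun q => ?_⟩
      · rw [Tw.inv_c, hx.1]; rfl
      · rw [Tw.inv_b, map_inv, InvMemClass.coe_inv, hx.2, hx.1, toAdd_inv, sub_add_cancel,
          sub_eq_add_neg]
        group
  have hker : ∀ h : π.ker, (Φ h.1).c = 0 := by
    intro h
    rw [(key h.1).1, h.2]; rfl
  let ψ : π.ker →* PresentedGroup R :=
    { toFun := fun h => (Φ h.1).b 0
      map_one' := by
        rw [Subgroup.coe_one, map_one, Tw.one_b]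
      map_mul' := by
        intro x y
        rw [Subgroup.coe_mul, map_mul, Tw.mul_b, hker y, add_zero] }
  refine fp_of_retract R hR f ψ ?_
  intro h
  apply Subtype.ext
  have h1 := (key h.1).2 0
  rw [MonoidHom.mem_ker.mp h.2, toAdd_one, add_zero, τ0] at h1
  rw [inv_one, one_mul, mul_one] at h1
  exact h1

end DartsFP

section Geometry

universe u

theorem exists_rank {Q : Type u} [Countable Q] (h : Q → ℕ) (hfin : ∀ n, {q | h q ≤ n}.Finite) :
    ∃ r : Q → ℕ, Function.Injective r ∧ ∀ p q, h p < h q → r p < r q := by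
  obtain ⟨e, he⟩ := exists_injective_nat Q
  let key : Q → ℕ ×ₗ ℕ := fun q => toLex (h q, e q)
  have hkey : Function.Injective key := by
    intro a b hab
    have h1 : (h a, e a) = (h b, e b) := toLex.injective hab
    exact he (Prod.ext_iff.mp h1).2
  have hf : ∀ q, {p | key p < key q}.Finite := by
    intro q
    apply (hfin (h q)).subset
    intro p hp
    have hp' : toLex (h p, e p) < toLex (h q, e q) := hp
    rw [Prod.Lex.toLex_lt_toLex] at hp'
    rcases hp' with h1 | h1
    · exact le_of_lt h1
    · exact le_of_eq h1.1
  let r : Q → ℕ := fun q => {p | key p < key q}.ncard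
  have hlt : ∀ p q, key p < key q → r p < r q := by
    intro p q hpq
    apply Set.ncard_lt_ncard _ (hf q)
    refine ⟨fun x hx => lt_trans hx hpq, fun hsub => ?_⟩
    have : key p < key p := hsub hpq
    exact lt_irrefl _ this
  refine ⟨r, ?_, ?_⟩
  · intro p q hpq
    rcases lt_trichotomy (key p) (key q) with h1 | h1 | h1
    · exact absurd hpq (ne_of_lt (hlt _ _ h1))
    · exact hkey h1
    · exact absurd hpq (ne_of_gt (hlt _ _ h1))
  · intro p q hpq
    apply hlt
    change toLex (h p, e p) < toLex (h q, e q)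
    rw [Prod.Lex.toLex_lt_toLex]
    exact Or.inl hpq

variable {V : Type u} [Fintype V] [DecidableEq V]

/-- The vector attached to a generator on one of the two sides. -/
def baseVec (M : Matrix V V ℤ) (s : Bool) (v : V) : V → ℤ :=
  if s then (fun i => M i v) else - Pi.single v 1

/-- General position of a unimodular matrix. -/
def GenPos (M : Matrix V V ℤ) : Prop :=
  ∀ I J : Finset V, Fintype.card V ≤ I.card + J.card →
    ∀ p : V → ℤ, (∀ v ∈ I, p v = 0) → (∀ v ∈ J, ∑ i, p i * M i v = 0) → p = 0

theorem genPos_dot {M : Matrix V V ℤ} (hM : GenPos M) (W : Bool → Finset V)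
    (hW : Fintype.card V ≤ (W true).card + (W false).card) (p : V → ℤ)
    (hp : ∀ s, ∀ v ∈ W s, p ⬝ᵥ baseVec M s v = 0) : p = 0 := by
  refine hM (W false) (W true) (by omega) p ?_ ?_
  · intro v hv
    have := hp false v hv
    simpa [baseVec] using this
  · intro v hv
    exact hp true v hv

theorem baseVec_mulVec (M : Matrix V V ℤ) (v : V) :
    M.mulVec (Pi.single v 1) = baseVec M true v := by
  ext i
  simp [baseVec]

theorem baseVec_mixed {M : Matrix V V ℤ} (hdet : M.det = 1) (hM : GenPos M)
    (hn : 2 ≤ Fintype.card V) (v w : V) (e e' : ℤˣ) :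
    (e : ℤ) • baseVec M true v + (e' : ℤ) • baseVec M false w ≠ 0 := by
  intro h
  have : Nontrivial V := Fintype.one_lt_card_iff_nontrivial.mp hn
  obtain ⟨x, hx⟩ := exists_ne v
  have hNM : M⁻¹ * M = 1 := Matrix.nonsing_inv_mul M (by rw [hdet]; exact isUnit_one)
  have hrow : ∀ y, (M⁻¹ x) ⬝ᵥ baseVec M true y = if x = y then 1 else 0 := by
    intro y
    have := congrFun (congrFun hNM x) y
    rw [Matrix.mul_apply, Matrix.one_apply] at this
    exact this
  have h0 : M⁻¹ x = 0 := by
    apply genPos_dot hM (fun s => if s then Finset.univ.erase x else {w})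
    · simp only [if_true, Finset.card_erase_of_mem (Finset.mem_univ x), Finset.card_univ]
      simp
      omega
    · intro s y hy
      cases s with
      | true =>
        simp only [if_true, Finset.mem_erase] at hy
        rw [hrow, if_neg (Ne.symm hy.1)]
      | false =>
        simp only [Bool.false_eq_true, if_false, Finset.mem_singleton] at hy
        subst hy
        have h1 := congrArg (fun q => (M⁻¹ x) ⬝ᵥ q) h
        simp only [dotProduct_add, dotProduct_smul, dotProduct_zero] at h1
        rw [hrow, if_neg hx, smul_zero, zero_add, smul_eq_mul] at h1
        exact (mul_eq_zero.mp h1).resolve_left (Units.ne_zero e')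
  have := hrow x
  rw [h0, if_pos rfl, zero_dotProduct] at this
  exact zero_ne_one this

theorem baseVec_same {M : Matrix V V ℤ} (hdet : M.det = 1) (s : Bool) (v w : V) (hvw : v ≠ w)
    (a b : ℤ) (ha : a ≠ 0) : a • baseVec M s v + b • baseVec M s w ≠ 0 := by
  intro h
  cases s with
  | true =>
    rw [← baseVec_mulVec, ← baseVec_mulVec, ← Matrix.mulVec_smul, ← Matrix.mulVec_smul,
      ← Matrix.mulVec_add] at h
    have h0 := Matrix.eq_zero_of_mulVec_eq_zero (by rw [hdet]; exact one_ne_zero) h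
    have := congrFun h0 v
    simp [hvw, ha] at this
  | false =>
    have := congrFun h v
    simp [baseVec, hvw, ha] at this

/-- The dart system of the twisted fibre product. -/
def raagDarts (Δ : SimpleGraph V) (M : Matrix V V ℤ) (hdet : M.det = 1) (hM : GenPos M)
    (hn : 2 ≤ Fintype.card V) : DartSys (V → ℤ) (Bool × V × ℤˣ) where
  vec := fun d => (d.2.2 : ℤ) • baseVec M d.1 d.2.1
  inv := fun d => (d.1, d.2.1, -d.2.2)
  adj := fun a b => a.1 ≠ b.1 ∨ Δ.Adj a.2.1 b.2.1
  side := fun d => d.1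
  vec_inv := by intro d; simp
  inv_inv := by intro d; simp
  adj_symm := by
    rintro a b (h | h)
    · exact Or.inl h.symm
    · exact Or.inr h.symm
  adj_inv := by intro a b h; exact h
  adj_side := by intro a b h; exact Or.inl h
  vec_ne := by
    rintro ⟨s, v, e⟩ h
    have : Nontrivial V := Fintype.one_lt_card_iff_nontrivial.mp hn
    obtain ⟨x, hx⟩ := exists_ne v
    apply baseVec_same hdet s v x hx.symm e 0 (Units.ne_zero e)
    simpa using h
  vec_add_ne := by
    rintro ⟨s, v, e⟩ ⟨s', w, e'⟩ hadj
    simp only at hadj ⊢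
    by_cases hs : s = s'
    · subst hs
      have hvw : Δ.Adj v w := hadj.resolve_left (fun h => h rfl)
      exact baseVec_same hdet s v w hvw.ne _ _ (Units.ne_zero e)
    · cases s <;> cases s'
      · exact absurd rfl hs
      · rw [add_comm]; exact baseVec_mixed hdet hM hn _ _ _ _
      · exact baseVec_mixed hdet hM hn _ _ _ _
      · exact absurd rfl hs

theorem box_finite {M : Matrix V V ℤ} (hM : GenPos M) (C : ℤ) (W : Bool → Finset V)
    (hW : Fintype.card V ≤ (W true).card + (W false).card) :
    {p : V → ℤ | ∀ s, ∀ v ∈ W s, |p ⬝ᵥ baseVec M s v| ≤ C}.Finite := by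
  let φ : (V → ℤ) → (Bool × V → ℤ) := fun p x =>
    if x.2 ∈ W x.1 then p ⬝ᵥ baseVec M x.1 x.2 else 0
  have hφ : Function.Injective φ := by
    intro p q hpq
    rw [← sub_eq_zero]
    apply genPos_dot hM W hW
    intro s v hv
    have := congrFun hpq (s, v)
    simp only [φ, if_pos hv] at this
    rw [sub_dotProduct, this, sub_self]
  apply Set.Finite.of_finite_image _ hφ.injOn
  apply (Set.finite_Icc (fun _ => -|C| : Bool × V → ℤ) (fun _ => |C|)).subset
  rintro _ ⟨p, hp, rfl⟩
  have : ∀ x, |φ p x| ≤ |C| := by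
    intro x
    simp only [φ]
    split_ifs with hx
    · exact (hp x.1 x.2 hx).trans (le_abs_self C)
    · simp
  exact ⟨fun x => (abs_le.mp (this x)).1, fun x => (abs_le.mp (this x)).2⟩

theorem weak_finite {M : Matrix V V ℤ} (hM : GenPos M) (C : ℤ) :
    {p : V → ℤ | Fintype.card V ≤
      (Finset.univ.filter (fun v => |p ⬝ᵥ baseVec M true v| ≤ C)).card +
      (Finset.univ.filter (fun v => |p ⬝ᵥ baseVec M false v| ≤ C)).card}.Finite := by
  apply (Set.finite_iUnion (fun W : {W : Bool → Finset V //
    Fintype.card V ≤ (W true).card + (W false).card} => box_finite hM C W.1 W.2)).subset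
  intro p hp
  rw [Set.mem_iUnion]
  refine ⟨⟨fun s => Finset.univ.filter (fun v => |p ⬝ᵥ baseVec M s v| ≤ C), hp⟩, ?_⟩
  intro s v hv
  simpa using hv

theorem normSq_finite (n : ℕ) : {q : V → ℤ | (q ⬝ᵥ q).toNat ≤ n}.Finite := by
  apply (Set.finite_Icc (fun _ => -(n : ℤ) : V → ℤ) (fun _ => (n : ℤ))).subset
  intro q hq
  have h1 : q ⬝ᵥ q ≤ n := Int.toNat_le.mp hq
  have h2 : ∀ v, |q v| ≤ n := by
    intro v
    have h3 : q v * q v ≤ q ⬝ᵥ q :=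
      Finset.single_le_sum (f := fun v => q v * q v) (fun i _ => mul_self_nonneg (q i))
        (Finset.mem_univ v)
    have h4 : |q v| ≤ q v * q v := by
      rw [← abs_mul_abs_self]
      rcases eq_or_ne (q v) 0 with h | h
      · simp [h]
      · have : 1 ≤ |q v| := Int.one_le_abs h
        nlinarith
    omega
  exact ⟨fun x => (abs_le.mp (h2 x)).1, fun x => (abs_le.mp (h2 x)).2⟩

/-- Graph-theoretic input at a vertex far away from the origin. -/
theorem walk_transport {Δ : SimpleGraph V} (T : Finset V) (P : V → Prop)
    (hstep : ∀ x y, x ∉ T → y ∉ T → Δ.Adj x y → P x → P y)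
    (hpre : (SimpleGraph.induce ((↑T : Set V)ᶜ) Δ).Preconnected)
    (x y : V) (hx : x ∉ T) (hy : y ∉ T) (hPx : P x) : P y := by
  obtain ⟨w⟩ := hpre ⟨x, by simpa using hx⟩ ⟨y, by simpa using hy⟩
  have : ∀ (a b : ↑((↑T : Set V)ᶜ)) (w : (SimpleGraph.induce ((↑T : Set V)ᶜ) Δ).Walk a b),
      P a.1 → P b.1 := by
    intro a b w
    induction w with
    | nil => exact id
    | @cons a b c h _ ih =>
      intro ha
      apply ih
      exact hstep a.1 b.1 (fun hh => a.2 (Finset.mem_coe.mpr hh))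
        (fun hh => b.2 (Finset.mem_coe.mpr hh)) (by simpa using h) ha
  exact this _ _ w hPx

theorem exists_nbr {Δ : SimpleGraph V} (T : Finset V) (hn : 2 ≤ Fintype.card V)
    (hT : 2 * T.card < Fintype.card V)
    (hsep : ∀ T : Finset V, 2 * T.card < Fintype.card V →
      (SimpleGraph.induce ((↑T : Set V)ᶜ) Δ).Preconnected) (v : V) :
    ∃ x, x ∉ T ∧ Δ.Adj x v := by
  by_contra hcon
  push Not at hcon
  have hc : (insert v T).card < Fintype.card V := by
    have := Finset.card_insert_le v T
    omega
  obtain ⟨w, hw⟩ : ∃ w, w ∉ insert v T := by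
    by_contra h
    push Not at h
    rw [Finset.eq_univ_of_forall h, Finset.card_univ] at hc
    exact lt_irrefl _ hc
  rw [Finset.mem_insert, not_or] at hw
  have hle : (T.erase v).card ≤ T.card := Finset.card_erase_le
  have hpre := hsep (T.erase v) (by omega)
  apply hw.1
  refine walk_transport (T.erase v) (fun x => x = v) ?_ hpre v w (by simp) (by simp [hw.2]) rfl
  intro x y hx hy hxy e
  subst e
  by_contra hne
  exact hcon y (fun h => hy (Finset.mem_erase.mpr ⟨hne, h⟩)) hxy.symm

end Geometry

section Geometry2

universe u

variable {V : Type u} [Fintype V] [DecidableEq V]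

theorem raag_goodAt (Δ : SimpleGraph V) (M : Matrix V V ℤ) (hdet : M.det = 1) (hM : GenPos M)
    (hn : 2 ≤ Fintype.card V)
    (hsep : ∀ T : Finset V, 2 * T.card < Fintype.card V →
      (SimpleGraph.induce ((↑T : Set V)ᶜ) Δ).Preconnected) :
    ∃ (r : (V → ℤ) → ℕ) (k0 : ℕ) (z : (V → ℤ) → Bool × V × ℤˣ), Function.Injective r ∧
      r 0 < k0 ∧ ∀ q, k0 ≤ r q → ∃ s c0 St,
        GoodAt (raagDarts Δ M hdet hM hn) {p | r p < r q} q (z q) s c0 St := by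
  classical
  set S := raagDarts Δ M hdet hM hn with hS
  obtain ⟨r, hr, hlt⟩ := exists_rank (fun q : V → ℤ => (q ⬝ᵥ q).toNat) normSq_finite
  have hlt' : ∀ p q : V → ℤ, p ⬝ᵥ p < q ⬝ᵥ q → r p < r q := by
    intro p q h
    apply hlt
    have h1 : 0 ≤ p ⬝ᵥ p := Finset.sum_nonneg (fun i _ => mul_self_nonneg (p i))
    omega
  obtain ⟨C, hC⟩ : ∃ C : ℤ, ∀ a b : Bool × V × ℤˣ, |S.vec a ⬝ᵥ S.vec b| ≤ C := by
    obtain ⟨C, hC⟩ := (Set.finite_range (fun x : (Bool × V × ℤˣ) × (Bool × V × ℤˣ) =>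
      |S.vec x.1 ⬝ᵥ S.vec x.2|)).bddAbove
    exact ⟨C, fun a b => hC ⟨(a, b), rfl⟩⟩
  have : Nontrivial V := Fintype.one_lt_card_iff_nontrivial.mp hn
  have : Nonempty V := inferInstance
  have hC0 : 0 ≤ C := (abs_nonneg _).trans (hC (true, Classical.arbitrary V, 1)
    (true, Classical.arbitrary V, 1))
  let St : (V → ℤ) → Bool × V × ℤˣ → Prop := fun q d => q ⬝ᵥ S.vec d < -(3 * C)
  have hdrop : ∀ (p : V → ℤ) d, p ⬝ᵥ S.vec d < -C → r (p + S.vec d) < r p := by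
    intro p d h
    apply hlt'
    rw [add_dotProduct, dotProduct_add, dotProduct_add, dotProduct_comm (S.vec d) p]
    have := abs_le.mp (hC d d)
    linarith
  have hvec : ∀ (q : V → ℤ) s v (e : ℤˣ), q ⬝ᵥ S.vec (s, v, e) = e * (q ⬝ᵥ baseVec M s v) := by
    intro q s v e
    change q ⬝ᵥ ((e : ℤ) • baseVec M s v) = _
    rw [dotProduct_smul, smul_eq_mul]
  let W : (V → ℤ) → Bool → Finset V := fun q s =>
    Finset.univ.filter (fun v => |q ⬝ᵥ baseVec M s v| ≤ 3 * C)
  have hWst : ∀ q s v, v ∉ W q s → ∃ e, St q (s, v, e) := by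
    intro q s v hv
    simp only [W, Finset.mem_filter, Finset.mem_univ, true_and, not_le] at hv
    rcases lt_abs.mp hv with h | h
    · refine ⟨-1, ?_⟩
      simp only [St, hvec]
      push_cast
      linarith
    · refine ⟨1, ?_⟩
      simp only [St, hvec]
      push_cast
      linarith
  have hstW : ∀ q s v e, St q (s, v, e) → v ∉ W q s := by
    intro q s v e h
    simp only [St, hvec] at h
    simp only [W, Finset.mem_filter, Finset.mem_univ, true_and, not_le]
    rcases Int.units_eq_one_or e with rfl | rfl
    · push_cast at h
      exact lt_abs.mpr (Or.inr (by linarith))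
    · push_cast at h
      exact lt_abs.mpr (Or.inl (by linarith))
  have huniq : ∀ q s v e e', St q (s, v, e) → St q (s, v, e') → e = e' := by
    intro q s v e e' h h'
    simp only [St, hvec] at h h'
    rcases Int.units_eq_one_or e with rfl | rfl <;> rcases Int.units_eq_one_or e' with rfl | rfl
    · rfl
    · push_cast at h h'
      linarith
    · push_cast at h h'
      linarith
    · rfl
  have hXfin := weak_finite hM (3 * C)
  obtain ⟨k1, hk1⟩ := ((hXfin.insert 0).image r).bddAbove
  have hgood : ∀ q, k1 + 1 ≤ r q → ∃ z s c0, GoodAt S {p | r p < r q} q z s c0 (St q) := by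
    intro q hq
    have hqX : (W q true).card + (W q false).card < Fintype.card V := by
      by_contra h
      have : r q ≤ k1 := hk1 ⟨q, Or.inr (not_lt.mp h), rfl⟩
      omega
    obtain ⟨s, hs⟩ : ∃ s, 2 * (W q s).card < Fintype.card V := by
      by_contra h
      push Not at h
      have h1 := h true
      have h2 := h false
      omega
    have hex : ∀ s', ∃ v, v ∉ W q s' := by
      intro s'
      by_contra h
      push Not at h
      have h1 := congrArg Finset.card (Finset.eq_univ_of_forall h)
      rw [Finset.card_univ] at h1
      cases s' <;> omega
    obtain ⟨v, hv⟩ := hex (!s)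
    obtain ⟨e, he⟩ := hWst q _ v hv
    obtain ⟨v0, hv0⟩ := hex s
    obtain ⟨e0, he0⟩ := hWst q _ v0 hv0
    refine ⟨(!s, v, e), s, (s, v0, e0), ?_⟩
    have hb : ∀ a d, -C ≤ S.vec a ⬝ᵥ S.vec d ∧ S.vec a ⬝ᵥ S.vec d ≤ C := fun a d =>
      abs_le.mp (hC a d)
    refine ⟨?_, ?_, ?_, he, ?_, he0, rfl, ?_, ?_⟩
    · intro d hd
      have hd' : q ⬝ᵥ S.vec d < -(3 * C) := hd
      exact hdrop q d (by linarith)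
    · intro d a hd ha
      have hd' : q ⬝ᵥ S.vec d < -(3 * C) := hd
      refine lt_trans (hdrop (q + S.vec a) d ?_) ha
      rw [add_dotProduct]
      have := hb a d
      linarith
    · intro d a b hd ha
      have hd' : q ⬝ᵥ S.vec d < -(3 * C) := hd
      refine lt_trans (hdrop (q + S.vec a + S.vec b) d ?_) ha
      rw [add_dotProduct, add_dotProduct]
      have := hb a d
      have := hb b d
      linarith
    · change (!s) ≠ s
      simp
    · rintro P hP0 hstep ⟨s', v', e'⟩ hst hside
      have hside' : s' = s := hside
      subst hside'
      have hP := walk_transport (Δ := Δ) (W q s') (fun x => ∀ e, St q (s', x, e) → P (s', x, e)) ?_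
        (hsep _ hs) v0 v' hv0 (hstW _ _ _ _ hst) ?_
      · exact hP e' hst
      · intro x y hx hy hxy hPx e'' hy'
        obtain ⟨ex, hex'⟩ := hWst q s' x hx
        exact hstep _ _ hex' hy' rfl rfl (Or.inr hxy) (hPx ex hex')
      · intro e'' h''
        rw [huniq _ _ _ _ _ h'' he0]
        exact hP0
    · rintro ⟨s', v', e'⟩ hside
      have hside' : s' = s := hside
      subst hside'
      obtain ⟨x, hx, hadj⟩ := exists_nbr (Δ := Δ) (W q s') hn hs hsep v'
      obtain ⟨ex, hex'⟩ := hWst q s' x hx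
      exact ⟨(s', x, ex), hex', rfl, Or.inr hadj⟩
  have hz : ∀ q, ∃ z, k1 + 1 ≤ r q → ∃ s c0, GoodAt S {p | r p < r q} q z s c0 (St q) := by
    intro q
    by_cases h : k1 + 1 ≤ r q
    · obtain ⟨z, hz⟩ := hgood q h
      exact ⟨z, fun _ => hz⟩
    · exact ⟨(true, Classical.arbitrary V, 1), fun h' => absurd h' h⟩
  choose z hz using hz
  refine ⟨r, k1 + 1, z, hr, ?_, ?_⟩
  · exact Nat.lt_succ_of_le (hk1 ⟨0, Or.inl rfl, rfl⟩)
  · intro q hq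
    obtain ⟨s, c0, h⟩ := hz q hq
    exact ⟨s, c0, St q, h⟩

end Geometry2

section Final

universe u

variable {V : Type u}

theorem raag_closure (Δ : SimpleGraph V) : Subgroup.closure (Set.range (raagOf Δ)) = ⊤ :=
  PresentedGroup.closure_range_of (raagRels Δ)

theorem raag_commute {Δ : SimpleGraph V} {T : Type*} [Group T] (f : RAAG Δ →* T) (x : T)
    (h : ∀ v, Commute x (f (raagOf Δ v))) (g : RAAG Δ) : Commute x (f g) := by
  have : (MulAut.conj x).toMonoidHom.comp f = f := by
    apply raag_hom_ext
    intro v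
    change x * f (raagOf Δ v) * x⁻¹ = f (raagOf Δ v)
    rw [(h v).eq, mul_inv_cancel_right]
  have h2 : x * f g * x⁻¹ = f g := DFunLike.congr_fun this g
  exact mul_inv_eq_iff_eq_mul.mp h2

/-- Generators of the product of two copies. -/
def pairGen (Δ : SimpleGraph V) (d : Bool × V × ℤˣ) : RAAG Δ × RAAG Δ :=
  (if d.1 then (raagOf Δ d.2.1, 1) else (1, raagOf Δ d.2.1)) ^ (d.2.2 : ℤ)

variable [Fintype V] [DecidableEq V]

/-- The map whose kernel is the twisted fibre product. -/
def pairPi (Δ : SimpleGraph V) (M : Matrix V V ℤ) :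
    RAAG Δ × RAAG Δ →* Multiplicative (V → ℤ) where
  toFun := fun g => Multiplicative.ofAdd
    (M.mulVec (raagAb Δ g.1).toAdd - (raagAb Δ g.2).toAdd)
  map_one' := by simp
  map_mul' := by
    intro x y
    rw [← ofAdd_add, Prod.fst_mul, Prod.snd_mul, map_mul (raagAb Δ), map_mul (raagAb Δ),
      toAdd_mul, toAdd_mul,
      Matrix.mulVec_add]
    congr 1
    abel

theorem pairPi_apply (Δ : SimpleGraph V) (M : Matrix V V ℤ) (g : RAAG Δ × RAAG Δ) :
    pairPi Δ M g = Multiplicative.ofAdd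
      (M.mulVec (raagAb Δ g.1).toAdd - (raagAb Δ g.2).toAdd) := rfl

theorem fp_pairPi (Δ : SimpleGraph V) (M : Matrix V V ℤ) (hdet : M.det = 1) (hM : GenPos M)
    (hn : 2 ≤ Fintype.card V)
    (hsep : ∀ T : Finset V, 2 * T.card < Fintype.card V →
      (SimpleGraph.induce ((↑T : Set V)ᶜ) Δ).Preconnected) :
    FinitelyPresentedGroup (pairPi Δ M).ker := by
  obtain ⟨r, k0, z, hr, hr0, hg⟩ := raag_goodAt Δ M hdet hM hn hsep
  refine fp_of_darts (raagDarts Δ M hdet hM hn) r hr k0 hr0 z hg (pairGen Δ) ?_ ?_ ?_ ?_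
    (pairPi Δ M) ?_ ?_
  · rintro ⟨s, v, e⟩
    change (_ : RAAG Δ × RAAG Δ) ^ ((-e : ℤˣ) : ℤ) = _
    rw [Units.val_neg, zpow_neg]
    rfl
  · rintro ⟨s, v, e⟩ ⟨s', v', e'⟩ h
    have h' : s ≠ s' ∨ Δ.Adj v v' := h
    refine (Commute.zpow_zpow ?_ _ _).eq
    cases s <;> cases s'
    · have := raagOf_comm (h'.resolve_left (fun h => h rfl))
      exact Prod.ext rfl this
    · exact Prod.ext (by simp) (by simp)
    · exact Prod.ext (by simp) (by simp)
    · have := raagOf_comm (h'.resolve_left (fun h => h rfl))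
      exact Prod.ext this rfl
  · set K := Subgroup.closure (Set.range (pairGen Δ)) with hK
    have k1 : ∀ g, g ∈ K.comap (MonoidHom.inl (RAAG Δ) (RAAG Δ)) := by
      intro g
      have hle : Subgroup.closure (Set.range (raagOf Δ)) ≤
          K.comap (MonoidHom.inl (RAAG Δ) (RAAG Δ)) := by
        rw [Subgroup.closure_le]
        rintro _ ⟨v, rfl⟩
        exact Subgroup.subset_closure ⟨(true, v, 1), by simp [pairGen]⟩
      rw [raag_closure] at hle
      exact hle trivial
    have k2 : ∀ g, g ∈ K.comap (MonoidHom.inr (RAAG Δ) (RAAG Δ)) := by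
      intro g
      have hle : Subgroup.closure (Set.range (raagOf Δ)) ≤
          K.comap (MonoidHom.inr (RAAG Δ) (RAAG Δ)) := by
        rw [Subgroup.closure_le]
        rintro _ ⟨v, rfl⟩
        exact Subgroup.subset_closure ⟨(false, v, 1), by simp [pairGen]⟩
      rw [raag_closure] at hle
      exact hle trivial
    rw [eq_top_iff]
    rintro ⟨g1, g2⟩ _
    have := K.mul_mem (k1 g1) (k2 g2)
    simpa using this
  · intro T _ t ht hcomm
    have hadj : ∀ s u v, Δ.Adj u v →
        t (s, u, 1) * t (s, v, 1) = t (s, v, 1) * t (s, u, 1) :=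
      fun s u v h => hcomm _ _ (Or.inr h)
    let f : Bool → RAAG Δ →* T := fun s => raagLift Δ (fun v => t (s, v, 1)) (hadj s)
    have hf : ∀ s v, f s (raagOf Δ v) = t (s, v, 1) := fun s v => raagLift_of _ _ v
    have hc : ∀ x y, Commute (f true x) (f false y) := by
      intro x y
      apply raag_commute
      intro v
      symm
      apply raag_commute
      intro w
      rw [hf, hf]
      exact hcomm _ _ (Or.inl (by simp))
    refine ⟨MonoidHom.noncommCoprod (f true) (f false) hc, ?_⟩
    have h1 : ∀ s v, MonoidHom.noncommCoprod (f true) (f false) hc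
        (if s then (raagOf Δ v, 1) else (1, raagOf Δ v)) = t (s, v, 1) := by
      intro s v
      cases s <;> simp [hf]
    rintro ⟨s, v, e⟩
    unfold pairGen
    rw [map_zpow]
    simp only [h1]
    rcases Int.units_eq_one_or e with rfl | rfl
    · simp
    · have := ht (s, v, 1)
      rw [Units.val_neg, Units.val_one, zpow_neg, zpow_one]
      exact this.symm
  · rintro ⟨s, v, e⟩
    unfold pairGen
    rw [map_zpow]
    have h1 : pairPi Δ M (if s then (raagOf Δ v, 1) else (1, raagOf Δ v)) =
        Multiplicative.ofAdd (baseVec M s v) := by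
      cases s
      · simp [pairPi_apply, raagAb_of, baseVec]
      · simp only [if_true, pairPi_apply, raagAb_of, map_one, toAdd_ofAdd, toAdd_one, sub_zero,
          baseVec_mulVec]
    simp only [h1]
    rw [← ofAdd_zsmul]
    rfl
  · intro q
    obtain ⟨g, hg'⟩ := raagAb_surjective (Δ := Δ) (Multiplicative.ofAdd (-q.toAdd))
    refine ⟨(1, g), ?_⟩
    rw [pairPi_apply, hg']
    simp

theorem sufficiency_large (Δ : SimpleGraph V) (hn : 2 ≤ Fintype.card V)
    (hsep : ∀ T : Finset V, 2 * T.card < Fintype.card V →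
      (SimpleGraph.induce ((↑T : Set V)ᶜ) Δ).Preconnected) :
    ∃ μ : (RAAG Δ ⧸ commutator (RAAG Δ)) ≃* (RAAG Δ ⧸ commutator (RAAG Δ)),
        FinitelyPresentedGroup
          ↥(fibreProduct (commutator (RAAG Δ)) (commutator (RAAG Δ)) μ) := by
  obtain ⟨M, hdet, hM⟩ := exists_general_position V
  have hu : IsUnit M.det := by rw [hdet]; exact isUnit_one
  let m : (V → ℤ) ≃+ (V → ℤ) :=
    { toFun := M.mulVec
      invFun := M⁻¹.mulVec
      left_inv := fun x => by
        rw [Matrix.mulVec_mulVec, Matrix.nonsing_inv_mul M hu, Matrix.one_mulVec]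
      right_inv := fun x => by
        rw [Matrix.mulVec_mulVec, Matrix.mul_nonsing_inv M hu, Matrix.one_mulVec]
      map_add' := Matrix.mulVec_add M }
  let μ := ((raagAbEquiv Δ).trans m.toMultiplicative).trans (raagAbEquiv Δ).symm
  refine ⟨μ, ?_⟩
  have heq : fibreProduct (commutator (RAAG Δ)) (commutator (RAAG Δ)) μ = (pairPi Δ M).ker := by
    ext ⟨g1, g2⟩
    rw [MonoidHom.mem_ker, pairPi_apply]
    change (raagAbEquiv Δ).symm (m.toMultiplicative (raagAbEquiv Δ (QuotientGroup.mk g1))) =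
      QuotientGroup.mk g2 ↔ _
    rw [MulEquiv.symm_apply_eq, raagAbEquiv_mk, raagAbEquiv_mk]
    change Multiplicative.ofAdd (M.mulVec (raagAb Δ g1).toAdd) = raagAb Δ g2 ↔ _
    rw [ofAdd_eq_one, sub_eq_zero]
    exact Iff.rfl
  rw [heq]
  exact fp_pairPi Δ M hdet hM hn hsep

theorem sufficiency_small (Δ : SimpleGraph V) (hn : Fintype.card V ≤ 1) :
    ∃ μ : (RAAG Δ ⧸ commutator (RAAG Δ)) ≃* (RAAG Δ ⧸ commutator (RAAG Δ)),
        FinitelyPresentedGroup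
          ↥(fibreProduct (commutator (RAAG Δ)) (commutator (RAAG Δ)) μ) := by
  have hss : Subsingleton V := Fintype.card_le_one_iff_subsingleton.mp hn
  have hcomm : ∀ x y : RAAG Δ, Commute x y := by
    intro x y
    apply raag_commute (MonoidHom.id _)
    intro v
    symm
    apply raag_commute (MonoidHom.id _)
    intro w
    rw [Subsingleton.elim v w]
  have hbot : commutator (RAAG Δ) = ⊥ := by
    rw [eq_bot_iff, commutator_def, Subgroup.commutator_le]
    intro x _ y _
    rw [Subgroup.mem_bot, commutatorElement_eq_one_iff_mul_comm]
    exact hcomm x y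
  refine ⟨MulEquiv.refl _, ?_⟩
  set H := fibreProduct (commutator (RAAG Δ)) (commutator (RAAG Δ)) (MulEquiv.refl _) with hH
  have hmem : ∀ p : H, p.1.1 = p.1.2 := by
    rintro ⟨⟨a, b⟩, h⟩
    have h' : (QuotientGroup.mk a : RAAG Δ ⧸ commutator (RAAG Δ)) = QuotientGroup.mk b := h
    rw [QuotientGroup.eq, hbot, Subgroup.mem_bot, inv_mul_eq_one] at h'
    exact h'
  have hfin : (raagRels Δ).Finite := by
    apply (Set.finite_range (fun x : V × V => FreeGroup.of x.1 * FreeGroup.of x.2 *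
      (FreeGroup.of x.1)⁻¹ * (FreeGroup.of x.2)⁻¹)).subset
    rintro y ⟨a, b, _, rfl⟩
    exact ⟨(a, b), rfl⟩
  let k : RAAG Δ →* H :=
    { toFun := fun g => ⟨(g, g), rfl⟩
      map_one' := rfl
      map_mul' := fun _ _ => rfl }
  let ψ : H →* RAAG Δ := (MonoidHom.fst _ _).comp H.subtype
  exact fp_of_retract (raagRels Δ) hfin k ψ (fun h =>
    Subtype.ext (Prod.ext rfl (hmem h)))

theorem sufficiency (Δ : SimpleGraph V)
    (h : ∀ S : Finset V, IsMinimalSeparating Δ S → Fintype.card V ≤ 2 * S.card) :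
    ∃ μ : (RAAG Δ ⧸ commutator (RAAG Δ)) ≃* (RAAG Δ ⧸ commutator (RAAG Δ)),
        FinitelyPresentedGroup
          ↥(fibreProduct (commutator (RAAG Δ)) (commutator (RAAG Δ)) μ) := by
  by_cases hn : Fintype.card V ≤ 1
  · exact sufficiency_small Δ hn
  · refine sufficiency_large Δ (by omega) ?_
    intro T
    induction T using Finset.strongInduction with
    | H T ih =>
      intro hT
      by_contra hcon
      have := h T ⟨hcon, fun T' hT' => ih T' hT' (by
        have := Finset.card_lt_card hT'
        omega)⟩
      omega

end Final

/-- For a right-angled Artin group `G = G_Δ` on a finite graph with `n` vertices, there is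
an automorphism `μ` of `G/G'` whose twisted `G'`-fibre product is finitely presented iff
`n ≤ 2|S|` for every minimal separating set `S` of `Δ`. -/
theorem raag_exists_fp_twisted_fibre_product_iff {V : Type*} [Fintype V]
    (Δ : SimpleGraph V) :
    (∃ μ : (RAAG Δ ⧸ commutator (RAAG Δ)) ≃* (RAAG Δ ⧸ commutator (RAAG Δ)),
        FinitelyPresentedGroup
          ↥(fibreProduct (commutator (RAAG Δ)) (commutator (RAAG Δ)) μ)) ↔
      ∀ S : Finset V, IsMinimalSeparating Δ S → Fintype.card V ≤ 2 * S.card := by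
  classical
  constructor
  · rintro ⟨μ, hfp⟩ S hS
    exact necessity Δ μ hfp S hS.1
  · exact sufficiency Δ
end

section
/- Let n = k + m with 1 ≤ k ≤ m. In Euclidean space ℝⁿ with standard basis e₁,…,e_n, let U = span(e₁,…,e_k), W = span(e₁,…,e_m), and let L = ℤe₁ + … + ℤe_n be the standard lattice. Let Σ₁ and Σ₂ be open subsets of the unit sphere S^{n−1} such that [U] ⊆ Σ₂ and [W] ⊆ Σ₁, where [X] = {x/‖x‖ : 0 ≠ x ∈ X}. Then there exists a linear automorphism φ of ℝⁿ with φ(L) = L such that [φ(S^{n−1} ∖ Σ₂)] ⊆ −Σ₁, where −Σ₁ = {−x : x ∈ Σ₁}. -/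
/-- The standard integer lattice `L = ℤe₁ + … + ℤe_n` in `ℝⁿ`. -/
def intLattice (n : ℕ) : Set (EuclideanSpace ℝ (Fin n)) :=
  {x | ∀ i : Fin n, ∃ z : ℤ, x i = (z : ℝ)}

/-- The shift `(Sx)_i = x_{i+k}` (zero when out of range). -/
noncomputable def shiftMap (k n : ℕ) :
    EuclideanSpace ℝ (Fin n) →ₗ[ℝ] EuclideanSpace ℝ (Fin n) where
  toFun x := WithLp.toLp 2 (fun i : Fin n => if h : (i : ℕ) + k < n then x ⟨i + k, h⟩ else 0)
  map_add' x y := by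
    ext i
    by_cases h : (i : ℕ) + k < n <;> simp [h]
  map_smul' c x := by
    ext i
    by_cases h : (i : ℕ) + k < n <;> simp [h]

lemma shiftMap_apply (k n : ℕ) (x : EuclideanSpace ℝ (Fin n)) (i : Fin n) :
    shiftMap k n x i = if h : (i : ℕ) + k < n then x ⟨i + k, h⟩ else 0 := rfl

lemma mem_span_of_zero (j n : ℕ) (x : EuclideanSpace ℝ (Fin n))
    (hx : ∀ i : Fin n, j ≤ (i : ℕ) → x i = 0) :
    x ∈ Submodule.span ℝ {y : EuclideanSpace ℝ (Fin n) |
        ∃ i : Fin n, (i : ℕ) < j ∧ y = EuclideanSpace.single i (1 : ℝ)} := by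
  have h : x = ∑ i, x i • EuclideanSpace.single i (1 : ℝ) := by
    have := (EuclideanSpace.basisFun (Fin n) ℝ).sum_repr x
    simpa using this.symm
  rw [h]
  refine Submodule.sum_mem _ fun i _ => ?_
  by_cases hi : (i : ℕ) < j
  · exact Submodule.smul_mem _ _ (Submodule.subset_span ⟨i, hi, rfl⟩)
  · rw [hx i (not_lt.mp hi), zero_smul]
    exact Submodule.zero_mem _

/-- descending induction along the shift -/
lemma shift_induct {k n : ℕ} (hk : 1 ≤ k) (P : Fin n → Prop)
    (h0 : ∀ i : Fin n, (∀ h : (i : ℕ) + k < n, P ⟨i + k, h⟩) → P i) (i : Fin n) : P i := by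
  have key : ∀ d : ℕ, ∀ i : Fin n, n - (i : ℕ) ≤ d → P i := by
    intro d
    induction d with
    | zero => intro i hi; have := i.2; omega
    | succ d ih =>
      intro i hi
      refine h0 i fun h => ih _ ?_
      simp only
      omega
  exact key _ i le_rfl

/-- If `n = k + m` with `1 ≤ k ≤ m`, `Sig₁, Sig₂` are open subsets of the unit sphere of `ℝⁿ`
containing `[W]` and `[U]` respectively, where `U = span(e₁,…,e_k)` and
`W = span(e₁,…,e_m)`, then there is a lattice-preserving linear automorphism `φ` of `ℝⁿ`
with `[φ(S^{n-1} ∖ Sig₂)] ⊆ −Sig₁`. -/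
theorem exists_lattice_automorphism_pushing_complement
    (k m n : ℕ) (hk : 1 ≤ k) (hkm : k ≤ m) (hn : n = k + m)
    (Sig₁ Sig₂ : Set (EuclideanSpace ℝ (Fin n)))
    (hSig₁sub : Sig₁ ⊆ Metric.sphere (0 : EuclideanSpace ℝ (Fin n)) 1)
    (hSig₂sub : Sig₂ ⊆ Metric.sphere (0 : EuclideanSpace ℝ (Fin n)) 1)
    (hSig₁open : ∃ O : Set (EuclideanSpace ℝ (Fin n)), IsOpen O ∧
      Sig₁ = O ∩ Metric.sphere (0 : EuclideanSpace ℝ (Fin n)) 1)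
    (hSig₂open : ∃ O : Set (EuclideanSpace ℝ (Fin n)), IsOpen O ∧
      Sig₂ = O ∩ Metric.sphere (0 : EuclideanSpace ℝ (Fin n)) 1)
    (hU : ∀ x : EuclideanSpace ℝ (Fin n),
      x ∈ Submodule.span ℝ {y : EuclideanSpace ℝ (Fin n) |
        ∃ i : Fin n, (i : ℕ) < k ∧ y = EuclideanSpace.single i (1 : ℝ)} →
      ‖x‖ = 1 → x ∈ Sig₂)
    (hW : ∀ x : EuclideanSpace ℝ (Fin n),
      x ∈ Submodule.span ℝ {y : EuclideanSpace ℝ (Fin n) |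
        ∃ i : Fin n, (i : ℕ) < m ∧ y = EuclideanSpace.single i (1 : ℝ)} →
      ‖x‖ = 1 → x ∈ Sig₁) :
    ∃ φ : EuclideanSpace ℝ (Fin n) ≃ₗ[ℝ] EuclideanSpace ℝ (Fin n),
      φ '' intLattice n = intLattice n ∧
      ∀ x ∈ Metric.sphere (0 : EuclideanSpace ℝ (Fin n)) 1 \ Sig₂,
        (‖φ x‖)⁻¹ • (φ x) ∈ -Sig₁ := by
  obtain ⟨O₁, hO₁, rfl⟩ := hSig₁open
  obtain ⟨O₂, hO₂, rfl⟩ := hSig₂open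
  set S := shiftMap k n with hS
  have hScont : Continuous S := S.continuous_of_finiteDimensional
  set K : Set (EuclideanSpace ℝ (Fin n)) :=
    Metric.sphere 0 1 \ (O₂ ∩ Metric.sphere 0 1) with hK
  have hKc : IsCompact K := by
    have : K = Metric.sphere 0 1 \ O₂ := by
      ext x; simp only [hK, Set.mem_diff, Set.mem_inter_iff]; tauto
    rw [this]
    exact (isCompact_sphere _ _).diff hO₂
  have hSne : ∀ x ∈ K, S x ≠ 0 := by
    intro x hx h0
    apply hx.2
    refine hU x (mem_span_of_zero k n x fun i hi => ?_) (by simpa using hx.1)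
    have h1 : S x ⟨i - k, by omega⟩ = 0 := by rw [h0]; rfl
    rw [hS, shiftMap_apply] at h1
    have h2 : (i : ℕ) - k + k = i := by omega
    simpa [h2] using h1
  have hSW : ∀ x, ∀ c : ℝ, c • S x ∈ Submodule.span ℝ {y : EuclideanSpace ℝ (Fin n) |
        ∃ i : Fin n, (i : ℕ) < m ∧ y = EuclideanSpace.single i (1 : ℝ)} := by
    intro x c
    refine Submodule.smul_mem _ _ (mem_span_of_zero m n _ fun i hi => ?_)
    rw [hS, shiftMap_apply, dif_neg (by omega)]
  have hev : ∀ᶠ t : ℝ in nhds 0, ∀ x ∈ K,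
      (-(‖S x + t • x‖)⁻¹) • (S x + t • x) ∈ O₁ := by
    refine hKc.eventually_forall_of_forall_eventually fun x hx => ?_
    have hne := hSne x hx
    have hn0 : ‖S x‖ ≠ 0 := norm_ne_zero_iff.mpr hne
    have hmem : (-(‖S x + (0:ℝ) • x‖)⁻¹) • (S x + (0:ℝ) • x) ∈ O₁ := by
      rw [zero_smul, add_zero]
      refine (hW _ (hSW x _) ?_).1
      rw [norm_smul, norm_neg, norm_inv, norm_norm, inv_mul_cancel₀ hn0]
    have hc : Continuous fun p : EuclideanSpace ℝ (Fin n) × ℝ => S p.1 + p.2 • p.1 := by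
      fun_prop
    have hc2 : ContinuousAt (fun p : ℝ × EuclideanSpace ℝ (Fin n) =>
        (-(‖S p.2 + p.1 • p.2‖)⁻¹) • (S p.2 + p.1 • p.2)) (0, x) := by
      have hc' : Continuous fun p : ℝ × EuclideanSpace ℝ (Fin n) => S p.2 + p.1 • p.2 := by
        fun_prop
      refine ContinuousAt.smul (ContinuousAt.neg (ContinuousAt.inv₀ hc'.norm.continuousAt ?_))
        hc'.continuousAt
      simpa using hne
    exact hc2.eventually_mem (hO₁.mem_nhds hmem)
  have hlim := tendsto_one_div_add_atTop_nhds_zero_nat (𝕜 := ℝ)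
  obtain ⟨N', hN'⟩ := (hlim.eventually hev).exists
  set N : ℕ := N' + 1 with hN
  have hNpos : (0 : ℝ) < N := by positivity
  set f : EuclideanSpace ℝ (Fin n) →ₗ[ℝ] EuclideanSpace ℝ (Fin n) :=
    LinearMap.id + (N : ℝ) • S with hf
  have hfa : ∀ x, f x = x + (N : ℝ) • S x := fun x => rfl
  have hfi : ∀ x i, f x i = x i + N * (if h : (i : ℕ) + k < n then x ⟨i + k, h⟩ else 0) :=
    fun x i => rfl
  have hinj : Function.Injective f := by
    rw [injective_iff_map_eq_zero]
    intro x hx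
    ext i
    refine shift_induct hk (fun i => x i = 0) (fun i hi => ?_) i
    have h1 := hfi x i
    rw [hx] at h1
    by_cases h : (i : ℕ) + k < n
    · have h2 := hi h
      rw [dif_pos h, h2] at h1
      simpa using h1.symm
    · rw [dif_neg h] at h1
      simpa using h1.symm
  refine ⟨LinearEquiv.ofInjectiveEndo f hinj, ?_, ?_⟩
  · apply Set.Subset.antisymm
    · rintro _ ⟨x, hx, rfl⟩ i
      rw [LinearEquiv.coe_ofInjectiveEndo, hfi]
      obtain ⟨a, ha⟩ := hx i
      by_cases h : (i : ℕ) + k < n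
      · obtain ⟨b, hb⟩ := hx ⟨i + k, h⟩
        refine ⟨a + N * b, ?_⟩
        rw [dif_pos h, ha, hb]; push_cast; ring
      · refine ⟨a, ?_⟩
        rw [dif_neg h, ha]; ring
    · intro y hy
      obtain ⟨x, rfl⟩ := (LinearEquiv.ofInjectiveEndo f hinj).surjective y
      refine ⟨x, fun i => ?_, rfl⟩
      refine shift_induct hk (fun i => ∃ z : ℤ, x i = z) (fun i hi => ?_) i
      obtain ⟨a, ha⟩ := hy i
      rw [LinearEquiv.coe_ofInjectiveEndo, hfi] at ha
      by_cases h : (i : ℕ) + k < n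
      · obtain ⟨b, hb⟩ := hi h
        rw [dif_pos h, hb] at ha
        refine ⟨a - N * b, ?_⟩
        push_cast; linarith
      · rw [dif_neg h] at ha
        exact ⟨a, by linarith⟩
  · intro x hx
    rw [LinearEquiv.coe_ofInjectiveEndo, Set.mem_neg]
    have hx0 : x ≠ 0 := by
      rintro rfl
      simpa using hx.1
    have hfx : f x ≠ 0 := fun h => hx0 (hinj (by rw [h, map_zero]))
    have h1 := hN' x hx
    have h2 : S x + (1 / ((N' : ℝ) + 1)) • x = (N : ℝ)⁻¹ • f x := by
      rw [hfa, smul_add, smul_smul, inv_mul_cancel₀ hNpos.ne', one_smul, hN, one_div, add_comm]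
      push_cast
      rfl
    rw [h2, norm_smul, norm_inv, Real.norm_of_nonneg hNpos.le, mul_inv, inv_inv, smul_smul] at h1
    refine ⟨?_, ?_⟩
    · convert h1 using 1
      rw [← neg_smul]
      congr 1
      field_simp
    · rw [mem_sphere_zero_iff_norm, norm_neg, norm_smul, norm_inv, norm_norm,
        inv_mul_cancel₀ (norm_ne_zero_iff.mpr hfx)]
end
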